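/- arXiv:1209.4014 — 2 statements merged into one kernel-verified Lean document; each statement's English description precedes it below -/
import Mathlib

section
/- Let z_0, z_1, z_2, z_3, z_4 ∈ ℂ be nondegenerate. Let c = (c_{ijk})_{0≤i<j<k≤4} be real numbers and set f(w) = Σ_{0≤i<j<k≤4} c_{ijk} · χ_{convexHull ℝ {z_i,z_j,z_k}}(w). Suppose that f(w) ∈ {−1, 0, 1} for volume-almost every w ∈ ℂ, and that for every natural number k, ∫_ℂ f(w)·w^k dvolume(w) = 0. Then f(w) = 0 for volume-almost every w ∈ ℂ. -/
open MeasureTheory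

/-- A tuple of points in `ℂ` is nondegenerate if the points are pairwise distinct and no
three of them are collinear over `ℝ`. -/
def Nondegenerate {m : ℕ} (z : Fin m → ℂ) : Prop :=
  Function.Injective z ∧
    ∀ i j k : Fin m, i ≠ j → i ≠ k → j ≠ k → ¬Collinear ℝ ({z i, z j, z k} : Set ℂ)


/-- signed double area of a triangle -/
def orr (a b c : ℂ) : ℝ := (b.re - a.re) * (c.im - a.im) - (b.im - a.im) * (c.re - a.re)

lemma mem_tri (a b c w : ℂ) : w ∈ convexHull ℝ ({a, b, c} : Set ℂ) ↔
    ∃ s t : ℝ, 0 ≤ s ∧ 0 ≤ t ∧ s + t ≤ 1 ∧ w = a + s * (b - a) + t * (c - a) := by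
  rw [convexHull_insert (by simp), convexHull_pair]
  simp only [convexJoin, Set.mem_singleton_iff, Set.iUnion_iUnion_eq_left, Set.mem_iUnion, segment,
    Set.mem_ofPred_eq, exists_prop]
  constructor
  · rintro ⟨y, ⟨p, q, hp, hq, hpq, rfl⟩, r, u, hr, hu, hru, rfl⟩
    refine ⟨u * p, u * q, by positivity, by positivity, ?_, ?_⟩
    · have : u * p + u * q = u := by rw [← mul_add, hpq, mul_one]
      linarith
    · obtain rfl : r = 1 - u := by linarith
      obtain rfl : p = 1 - q := by linarith
      simp only [Complex.real_smul]
      push_cast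
      ring
  · rintro ⟨s, t, hs, ht, hst, rfl⟩
    rcases eq_or_lt_of_le (add_nonneg hs ht) with h | h
    · have h1 : s = 0 := by linarith
      have h2 : t = 0 := by linarith
      subst h1 h2
      exact ⟨b, ⟨1, 0, by simp⟩, 1, 0, by simp⟩
    · refine ⟨(s / (s + t)) • b + (t / (s + t)) • c,
        ⟨s / (s + t), t / (s + t), by positivity, by positivity, by field_simp, rfl⟩,
        1 - (s + t), s + t, by linarith, by linarith, by ring, ?_⟩
      have : ((s : ℂ) + t) ≠ 0 := by exact_mod_cast h.ne'
      simp only [Complex.real_smul]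
      push_cast
      field_simp
      ring

def simplexC : Set ℂ := {x | 0 ≤ x.re ∧ 0 ≤ x.im ∧ x.re + x.im ≤ 1}

noncomputable def linC (u v : ℂ) : ℂ →L[ℝ] ℂ :=
  Complex.reCLM.smulRight u + Complex.imCLM.smulRight v

lemma linC_apply (u v x : ℂ) : linC u v x = x.re * u + x.im * v := by
  simp [linC]

lemma linC_det (u v : ℂ) : (linC u v).det = u.re * v.im - u.im * v.re := by
  rw [ContinuousLinearMap.det, ← LinearMap.det_toMatrix Complex.basisOneI, Matrix.det_fin_two]
  simp [LinearMap.toMatrix_apply, linC_apply]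
  ring

lemma tri_eq_image (a b c : ℂ) :
    convexHull ℝ ({a, b, c} : Set ℂ) = Set.image (fun x => a + linC (b - a) (c - a) x) simplexC := by
  ext w
  rw [mem_tri]
  constructor
  · rintro ⟨s, t, hs, ht, hst, rfl⟩
    exact ⟨⟨s, t⟩, ⟨hs, ht, hst⟩, by simp [linC_apply, add_assoc]⟩
  · rintro ⟨x, ⟨h1, h2, h3⟩, rfl⟩
    exact ⟨x.re, x.im, h1, h2, h3, by simp [linC_apply, add_assoc]⟩

lemma measurableSet_simplexC : MeasurableSet simplexC := by
  apply IsClosed.measurableSet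
  refine IsClosed.inter (isClosed_le continuous_const Complex.continuous_re) (IsClosed.inter
    (isClosed_le continuous_const Complex.continuous_im)
    (isClosed_le (Complex.continuous_re.add Complex.continuous_im) continuous_const))

lemma isCompact_tri (a b c : ℂ) : IsCompact (convexHull ℝ ({a, b, c} : Set ℂ)) :=
  Set.Finite.isCompact_convexHull ℝ (Set.toFinite _)

lemma integral_tri (a b c : ℂ) (h : orr a b c ≠ 0) (g : ℂ → ℂ) :
    ∫ w in convexHull ℝ ({a, b, c} : Set ℂ), g w =
      |orr a b c| * ∫ x in simplexC, g (a + linC (b - a) (c - a) x) := by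
  rw [tri_eq_image, integral_image_eq_integral_abs_det_fderiv_smul volume measurableSet_simplexC
    (f' := fun _ => linC (b - a) (c - a))]
  · rw [integral_smul, linC_det, Complex.real_smul]
    congr 3
  · intro x _
    exact ((linC (b - a) (c - a)).hasFDerivAt.const_add a).hasFDerivWithinAt
  · intro x _ y _ hxy
    simp only [linC_apply, add_right_inj] at hxy
    have h1 := congrArg Complex.re hxy
    have h2 := congrArg Complex.im hxy
    simp at h1 h2
    unfold orr at h
    apply Complex.ext
    · have : (x.re - y.re) * ((b.re - a.re) * (c.im - a.im) - (b.im - a.im) * (c.re - a.re)) = 0 := by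
        linear_combination (c.im - a.im) * h1 - (c.re - a.re) * h2
      rcases mul_eq_zero.1 this with h | h
      · linarith
      · contradiction
    · have : (x.im - y.im) * ((b.re - a.re) * (c.im - a.im) - (b.im - a.im) * (c.re - a.re)) = 0 := by
        linear_combination -(b.im - a.im) * h1 + (b.re - a.re) * h2
      rcases mul_eq_zero.1 this with h | h
      · linarith
      · contradiction

lemma integral_simplexC (g : ℂ → ℂ) (hg : Continuous g) :
    ∫ x in simplexC, g x = ∫ s in (0:ℝ)..1, ∫ t in (0:ℝ)..(1 - s), g (⟨s, t⟩ : ℂ) := by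
  rw [← integral_indicator measurableSet_simplexC,
    ← Complex.volume_preserving_equiv_real_prod.symm.integral_comp'
      (g := simplexC.indicator g), Measure.volume_eq_prod, integral_prod]
  · rw [intervalIntegral.integral_of_le zero_le_one, ← integral_Icc_eq_integral_Ioc,
      ← integral_indicator measurableSet_Icc]
    congr 1
    ext s
    by_cases hs : s ∈ Set.Icc (0:ℝ) 1
    · rw [Set.indicator_of_mem hs, intervalIntegral.integral_of_le (by linarith [hs.2]),
        ← integral_Icc_eq_integral_Ioc, ← integral_indicator measurableSet_Icc]
      congr 1
      ext t
      by_cases ht : t ∈ Set.Icc 0 (1 - s)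
      · rw [Set.indicator_of_mem ht, Set.indicator_of_mem]
        · rfl
        · exact ⟨hs.1, ht.1, by have := ht.2; simp [Complex.measurableEquivRealProd]; linarith⟩
      · rw [Set.indicator_of_notMem ht, Set.indicator_of_notMem]
        rintro ⟨h1, h2, h3⟩
        simp [Complex.measurableEquivRealProd] at h1 h2 h3
        exact ht ⟨h2, by linarith⟩
    · rw [Set.indicator_of_notMem hs]
      apply integral_eq_zero_of_ae
      filter_upwards with t
      refine Set.indicator_of_notMem ?_ _
      rintro ⟨h1, h2, h3⟩
      simp [Complex.measurableEquivRealProd] at h1 h2 h3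
      exact hs ⟨h1, by linarith⟩
  · have hc : IsCompact simplexC := by
      have := isCompact_tri 0 1 Complex.I
      rw [tri_eq_image] at this
      convert this
      ext x
      simp [linC_apply]
    have : Integrable (simplexC.indicator g) := by
      rw [integrable_indicator_iff measurableSet_simplexC]
      exact hg.continuousOn.integrableOn_compact hc
    exact (Complex.volume_preserving_equiv_real_prod.symm.integrable_comp_emb
      (MeasurableEquiv.measurableEmbedding _)).2 this

/-- second divided difference -/
noncomputable def dd (G : Polynomial ℂ) (a b c : ℂ) : ℂ :=
  G.eval a / ((a - b) * (a - c)) + G.eval b / ((b - a) * (b - c)) + G.eval c / ((c - a) * (c - b))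

lemma int_poly (P : Polynomial ℂ) (p q : ℂ) (hq : q ≠ 0) (x y : ℝ) :
    ∫ t in x..y, P.derivative.eval (p + t * q) = (P.eval (p + y * q) - P.eval (p + x * q)) / q := by
  rw [intervalIntegral.integral_eq_sub_of_hasDerivAt (f := fun t : ℝ => P.eval (p + t * q) / q)]
  · ring
  · intro t _
    have h1 : HasDerivAt (fun t : ℝ => p + (t : ℂ) * q) (1 * q) t :=
      ((Complex.ofRealCLM.hasDerivAt (x := t)).mul_const q).const_add p
    have h2 := (P.hasDerivAt (p + t * q)).comp t h1
    have h3 := h2.div_const q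
    simpa [hq] using h3
  · apply Continuous.intervalIntegrable
    fun_prop

lemma integral_tri_poly (a b c : ℂ) (h : orr a b c ≠ 0) (G : Polynomial ℂ) :
    ∫ w in convexHull ℝ ({a, b, c} : Set ℂ), G.derivative.derivative.eval w =
      |orr a b c| * dd G a b c := by
  have hab : b - a ≠ 0 := by
    rintro h'; rw [sub_eq_zero] at h'; subst h'; simp [orr] at h
  have hac : c - a ≠ 0 := by
    rintro h'; rw [sub_eq_zero] at h'; subst h'; apply h; simp [orr]; try ring
  have hbc : b - c ≠ 0 := by
    rintro h'; rw [sub_eq_zero] at h'; subst h'; simp [orr] at h; apply h; ring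
  have hab' : a - b ≠ 0 := sub_ne_zero.2 (sub_ne_zero.1 hab).symm
  have hac' : a - c ≠ 0 := sub_ne_zero.2 (sub_ne_zero.1 hac).symm
  have hbc' : c - b ≠ 0 := sub_ne_zero.2 (sub_ne_zero.1 hbc).symm
  rw [integral_tri a b c h, integral_simplexC]
  · congr 1
    have e1 : ∀ s : ℝ, ∫ t in (0:ℝ)..(1 - s),
        G.derivative.derivative.eval (a + linC (b - a) (c - a) ⟨s, t⟩) =
        (G.derivative.eval (c + s * (b - c)) - G.derivative.eval (a + s * (b - a))) / (c - a) := by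
      intro s
      have := int_poly G.derivative (a + s * (b - a)) (c - a) hac 0 (1 - s)
      simp only [linC_apply, ← add_assoc]
      rw [this]
      congr 3
      · push_cast; ring
      · push_cast; ring
    simp_rw [e1]
    rw [intervalIntegral.integral_div, intervalIntegral.integral_sub, int_poly _ _ _ hbc,
      int_poly _ _ _ hab]
    · have e3 : c + ((1:ℝ) : ℂ) * (b - c) = b := by push_cast; ring
      have e4 : a + ((1:ℝ) : ℂ) * (b - a) = b := by push_cast; ring
      rw [e3, e4]
      simp only [Complex.ofReal_zero, zero_mul, add_zero, dd]
      generalize G.eval a = A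
      generalize G.eval b = B
      generalize G.eval c = C
      have x1 : a - b = -(b - a) := by ring
      have x2 : a - c = -(c - a) := by ring
      have x3 : c - b = -(b - c) := by ring
      rw [x1, x2, x3]
      field_simp
      ring
    · apply Continuous.intervalIntegrable; fun_prop
    · apply Continuous.intervalIntegrable; fun_prop
  · fun_prop

noncomputable def tt (a b : ℂ) : ℂ := (starRingEnd ℂ) (a - b) / (a - b)

/-- The combinatorial data extracted from a hypothetical counterexample. -/
structure Good (z : Fin 5 → ℂ) (E : Fin 5 → Fin 5 → ℤ) : Prop where
  nd : ∀ i j k, i ≠ j → i ≠ k → j ≠ k → orr (z i) (z j) (z k) ≠ 0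
  anti : ∀ i j, E i j = -E j i
  val : ∀ i j, i ≠ j → E i j = 1 ∨ E i j = -1 ∨ E i j = 2 ∨ E i j = -2
  sum : ∀ i, ∑ j, E i j = 0
  tsum : ∀ i, ∑ j, (E i j : ℂ) * tt (z i) (z j) = 0
  hull : ∀ i j, i ≠ j → (∀ k, k ≠ i → k ≠ j → 0 < orr (z i) (z j) (z k)) → E i j = 1 ∨ E i j = -1
  cross : ∀ i j k l, [i, j, k, l].Nodup → orr (z i) (z j) (z k) * orr (z i) (z j) (z l) < 0 →
    orr (z k) (z l) (z i) * orr (z k) (z l) (z j) < 0 → E i j = 1 ∨ E i j = -1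

def Bad (E : Fin 5 → Fin 5 → ℤ) (i j : Fin 5) : Prop := E i j = 2 ∨ E i j = -2

noncomputable def bit (r : ℝ) : Bool := decide (0 < r)

def cl4 (a b c d : Bool) : Bool := !(a && !b && c && !d) && !(!a && b && !c && d)
def clg (a b c d e f : Bool) : Bool :=
  !((a == b) && (c != d) && (e == f)) && !((a != b) && (c == d) && (e != f))
def clh (a b c : Bool) : Bool := !(a && b && c) && !(!a && !b && !c)
def clx (a b c d : Bool) : Bool := (a == b) || (c == d)

lemma bit_pos {r : ℝ} (h : 0 < r) : bit r = true := by simp [bit, h]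
lemma bit_neg {r : ℝ} (h : r < 0) : bit r = false := by simp [bit, h.le]

lemma bit_rot (a b c : ℂ) : bit (orr b c a) = bit (orr a b c) := by
  congr 1; unfold orr; ring
lemma bit_rot2 (a b c : ℂ) : bit (orr c a b) = bit (orr a b c) := by
  congr 1; unfold orr; ring
lemma bit_not (r s : ℝ) (h : r ≠ 0) (e : s = -r) : bit s = !bit r := by
  rcases lt_or_gt_of_ne h with h | h
  · rw [bit_neg h, bit_pos (by linarith)]; rfl
  · rw [bit_pos h, bit_neg (by linarith)]; rfl
lemma bit_sw1 (a b c : ℂ) (h : orr a b c ≠ 0) : bit (orr b a c) = !bit (orr a b c) :=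
  bit_not _ _ h (by unfold orr; ring)
lemma bit_sw2 (a b c : ℂ) (h : orr a b c ≠ 0) : bit (orr a c b) = !bit (orr a b c) :=
  bit_not _ _ h (by unfold orr; ring)
lemma bit_sw3 (a b c : ℂ) (h : orr a b c ≠ 0) : bit (orr c b a) = !bit (orr a b c) :=
  bit_not _ _ h (by unfold orr; ring)

lemma bit_beq (a b : ℝ) (ha : a ≠ 0) (hb : b ≠ 0) :
    (0 < a * b ∧ (bit a == bit b) = true) ∨ (a * b < 0 ∧ (bit a == bit b) = false) := by
  rcases lt_or_gt_of_ne ha with h | h <;> rcases lt_or_gt_of_ne hb with h' | h'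
  · left; rw [bit_neg h, bit_neg h']; exact ⟨mul_pos_of_neg_of_neg h h', rfl⟩
  · right; rw [bit_neg h, bit_pos h']; exact ⟨mul_neg_of_neg_of_pos h h', rfl⟩
  · right; rw [bit_pos h, bit_neg h']; exact ⟨mul_neg_of_pos_of_neg h h', rfl⟩
  · left; rw [bit_pos h, bit_pos h']; exact ⟨mul_pos h h', rfl⟩

lemma cl4_of (a b c d : ℝ) (ha : a ≠ 0) (hb : b ≠ 0) (hc : c ≠ 0) (hd : d ≠ 0)
    (h : a - b + c - d = 0) : cl4 (bit a) (bit b) (bit c) (bit d) = true := by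
  rcases lt_or_gt_of_ne ha with h1 | h1 <;> rcases lt_or_gt_of_ne hb with h2 | h2 <;>
  rcases lt_or_gt_of_ne hc with h3 | h3 <;> rcases lt_or_gt_of_ne hd with h4 | h4 <;>
  first
  | (exfalso; linarith)
  | (simp only [bit_neg, bit_pos, h1, h2, h3, h4]; rfl)

lemma clg_of (a b c d e f : ℝ) (ha : a ≠ 0) (hb : b ≠ 0) (hc : c ≠ 0) (hd : d ≠ 0)
    (he : e ≠ 0) (hf : f ≠ 0) (h : a * b - c * d + e * f = 0) :
    clg (bit a) (bit b) (bit c) (bit d) (bit e) (bit f) = true := by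
  unfold clg bne
  rcases bit_beq a b ha hb with ⟨h1, k1⟩ | ⟨h1, k1⟩ <;>
  rcases bit_beq c d hc hd with ⟨h2, k2⟩ | ⟨h2, k2⟩ <;>
  rcases bit_beq e f he hf with ⟨h3, k3⟩ | ⟨h3, k3⟩ <;>
  first
  | (exfalso; linarith)
  | (rw [k1, k2, k3]; rfl)

lemma Good.nohull {z : Fin 5 → ℂ} {E : Fin 5 → Fin 5 → ℤ} (G : Good z E) (i j k l m : Fin 5)
    (hd : [i, j, k, l, m].Nodup) (h : Bad E i j) :
    clh (bit (orr (z i) (z j) (z k))) (bit (orr (z i) (z j) (z l)))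
      (bit (orr (z i) (z j) (z m))) = true := by
  have hcov : ∀ i j k l m : Fin 5, [i, j, k, l, m].Nodup → i ≠ j ∧ i ≠ k ∧ i ≠ l ∧ i ≠ m ∧ j ≠ k ∧
      j ≠ l ∧ j ≠ m ∧ ∀ x, x ≠ i → x ≠ j → x = k ∨ x = l ∨ x = m := by decide +kernel
  obtain ⟨d1, d2, d3, d4, d5, d6, d7, hx⟩ := hcov i j k l m hd
  have hEE := G.anti i j
  have hE : ¬ (E i j = 1 ∨ E i j = -1) := by unfold Bad at h; omega
  have hE' : ¬ (E j i = 1 ∨ E j i = -1) := by unfold Bad at h; omega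
  have sw : ∀ a b c, orr b a c = - orr a b c := by intros; unfold orr; ring
  rcases lt_or_gt_of_ne (G.nd i j k d1 d2 d5) with h1 | h1 <;>
  rcases lt_or_gt_of_ne (G.nd i j l d1 d3 d6) with h2 | h2 <;>
  rcases lt_or_gt_of_ne (G.nd i j m d1 d4 d7) with h3 | h3 <;>
  first
  | (simp only [bit_neg, bit_pos, h1, h2, h3]; rfl)
  | (exfalso; apply hE; apply G.hull i j d1; intro x x1 x2
     rcases hx x x1 x2 with rfl | rfl | rfl <;> assumption)
  | (exfalso; apply hE'; apply G.hull j i d1.symm; intro x x1 x2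
     rw [sw]
     rcases hx x x2 x1 with rfl | rfl | rfl <;> linarith)

lemma Good.nocross {z : Fin 5 → ℂ} {E : Fin 5 → Fin 5 → ℤ} (G : Good z E) (i j k l : Fin 5)
    (hd : [i, j, k, l].Nodup) (h : Bad E i j) :
    clx (bit (orr (z i) (z j) (z k))) (bit (orr (z i) (z j) (z l)))
      (bit (orr (z k) (z l) (z i))) (bit (orr (z k) (z l) (z j))) = true := by
  have hcov : ∀ i j k l : Fin 5, [i, j, k, l].Nodup → i ≠ j ∧ i ≠ k ∧ i ≠ l ∧ j ≠ k ∧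
      j ≠ l ∧ k ≠ l := by decide +kernel
  obtain ⟨d1, d2, d3, d4, d5, d6⟩ := hcov i j k l hd
  have hE : ¬ (E i j = 1 ∨ E i j = -1) := by unfold Bad at h; omega
  unfold clx
  rcases bit_beq _ _ (G.nd i j k d1 d2 d4) (G.nd i j l d1 d3 d5) with ⟨h1, k1⟩ | ⟨h1, k1⟩ 
  · rw [k1]; rfl
  rcases bit_beq _ _ (G.nd k l i d6 d2.symm d3.symm) (G.nd k l j d6 d4.symm d5.symm)
    with ⟨h2, k2⟩ | ⟨h2, k2⟩
  · rw [k2]; simp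
  · exact absurd (G.cross i j k l hd h1 h2) hE

set_option synthInstance.maxHeartbeats 400000 in
set_option synthInstance.maxSize 4000 in
lemma bool_star : ∀ x012 x013 x014 x023 x024 x034 x123 x124 x134 x234 : Bool,
    cl4 x123 x023 x013 x012 = true →
    cl4 x124 x024 x014 x012 = true →
    cl4 x134 x034 x014 x013 = true →
    cl4 x234 x034 x024 x023 = true →
    cl4 x234 x134 x124 x123 = true →
    clg x012 x034 x013 x024 x014 x023 = true →
    clg (!x012) x134 (!x013) x124 (!x014) x123 = true →
    clg x012 x234 (!x023) (!x124) (!x024) (!x123) = true →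
    clg x013 (!x234) x023 (!x134) (!x034) x123 = true →
    clg x014 x234 x024 x134 x034 x124 = true →
    clh x012 x013 x014 = true →
    clx x012 x013 x023 x123 = true →
    clx x012 x014 x024 x124 = true →
    clx x013 x014 x034 x134 = true →
    clh x012 x123 x124 = true →
    clx x012 x123 (!x013) (!x023) = true →
    clx x012 x124 (!x014) (!x024) = true →
    clx x123 x124 x134 x234 = true →
    clh x013 (!x123) x134 = true →
    clx x013 (!x123) (!x012) x023 = true →
    clx x013 x134 (!x014) (!x034) = true →
    clx (!x123) x134 x124 (!x234) = true →
    clh x014 (!x124) (!x134) = true →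
    clx x014 (!x124) (!x012) x024 = true →
    clx x014 (!x134) (!x013) x034 = true →
    clx (!x124) (!x134) x123 x234 = true → False := by
  decide +kernel

lemma Good.no_star {z : Fin 5 → ℂ} {E : Fin 5 → Fin 5 → ℤ} (G : Good z E)
    (h01 : Bad E 0 1)
    (h12 : Bad E 1 2)
    (h13 : Bad E 1 3)
    (h14 : Bad E 1 4) : False := by
  refine bool_star (bit (orr (z 0) (z 1) (z 2))) (bit (orr (z 0) (z 1) (z 3))) (bit (orr (z 0) (z 1) (z 4))) (bit (orr (z 0) (z 2) (z 3))) (bit (orr (z 0) (z 2) (z 4))) (bit (orr (z 0) (z 3) (z 4))) (bit (orr (z 1) (z 2) (z 3))) (bit (orr (z 1) (z 2) (z 4))) (bit (orr (z 1) (z 3) (z 4))) (bit (orr (z 2) (z 3) (z 4)))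
    ?_ ?_ ?_ ?_ ?_ ?_ ?_ ?_ ?_ ?_ ?_ ?_ ?_ ?_ ?_ ?_ ?_ ?_ ?_ ?_ ?_ ?_ ?_ ?_ ?_ ?_
  · have h := cl4_of _ _ _ _ (G.nd 1 2 3 (by decide) (by decide) (by decide)) (G.nd 0 2 3 (by decide) (by decide) (by decide)) (G.nd 0 1 3 (by decide) (by decide) (by decide)) (G.nd 0 1 2 (by decide) (by decide) (by decide)) (by unfold orr; ring)
    exact h
  · have h := cl4_of _ _ _ _ (G.nd 1 2 4 (by decide) (by decide) (by decide)) (G.nd 0 2 4 (by decide) (by decide) (by decide)) (G.nd 0 1 4 (by decide) (by decide) (by decide)) (G.nd 0 1 2 (by decide) (by decide) (by decide)) (by unfold orr; ring)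
    exact h
  · have h := cl4_of _ _ _ _ (G.nd 1 3 4 (by decide) (by decide) (by decide)) (G.nd 0 3 4 (by decide) (by decide) (by decide)) (G.nd 0 1 4 (by decide) (by decide) (by decide)) (G.nd 0 1 3 (by decide) (by decide) (by decide)) (by unfold orr; ring)
    exact h
  · have h := cl4_of _ _ _ _ (G.nd 2 3 4 (by decide) (by decide) (by decide)) (G.nd 0 3 4 (by decide) (by decide) (by decide)) (G.nd 0 2 4 (by decide) (by decide) (by decide)) (G.nd 0 2 3 (by decide) (by decide) (by decide)) (by unfold orr; ring)
    exact h
  · have h := cl4_of _ _ _ _ (G.nd 2 3 4 (by decide) (by decide) (by decide)) (G.nd 1 3 4 (by decide) (by decide) (by decide)) (G.nd 1 2 4 (by decide) (by decide) (by decide)) (G.nd 1 2 3 (by decide) (by decide) (by decide)) (by unfold orr; ring)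
    exact h
  · have h := clg_of _ _ _ _ _ _ (G.nd 0 1 2 (by decide) (by decide) (by decide)) (G.nd 0 3 4 (by decide) (by decide) (by decide)) (G.nd 0 1 3 (by decide) (by decide) (by decide)) (G.nd 0 2 4 (by decide) (by decide) (by decide)) (G.nd 0 1 4 (by decide) (by decide) (by decide)) (G.nd 0 2 3 (by decide) (by decide) (by decide)) (by unfold orr; ring)
    exact h
  · have h := clg_of _ _ _ _ _ _ (G.nd 1 0 2 (by decide) (by decide) (by decide)) (G.nd 1 3 4 (by decide) (by decide) (by decide)) (G.nd 1 0 3 (by decide) (by decide) (by decide)) (G.nd 1 2 4 (by decide) (by decide) (by decide)) (G.nd 1 0 4 (by decide) (by decide) (by decide)) (G.nd 1 2 3 (by decide) (by decide) (by decide)) (by unfold orr; ring)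
    rw [bit_sw1 _ _ _ (G.nd 0 1 2 (by decide) (by decide) (by decide)),
      bit_sw1 _ _ _ (G.nd 0 1 3 (by decide) (by decide) (by decide)),
      bit_sw1 _ _ _ (G.nd 0 1 4 (by decide) (by decide) (by decide))] at h
    exact h
  · have h := clg_of _ _ _ _ _ _ (G.nd 2 0 1 (by decide) (by decide) (by decide)) (G.nd 2 3 4 (by decide) (by decide) (by decide)) (G.nd 2 0 3 (by decide) (by decide) (by decide)) (G.nd 2 1 4 (by decide) (by decide) (by decide)) (G.nd 2 0 4 (by decide) (by decide) (by decide)) (G.nd 2 1 3 (by decide) (by decide) (by decide)) (by unfold orr; ring)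
    rw [bit_rot2 (z 0) (z 1) (z 2),
      bit_sw1 _ _ _ (G.nd 0 2 3 (by decide) (by decide) (by decide)),
      bit_sw1 _ _ _ (G.nd 1 2 4 (by decide) (by decide) (by decide)),
      bit_sw1 _ _ _ (G.nd 0 2 4 (by decide) (by decide) (by decide)),
      bit_sw1 _ _ _ (G.nd 1 2 3 (by decide) (by decide) (by decide))] at h
    exact h
  · have h := clg_of _ _ _ _ _ _ (G.nd 3 0 1 (by decide) (by decide) (by decide)) (G.nd 3 2 4 (by decide) (by decide) (by decide)) (G.nd 3 0 2 (by decide) (by decide) (by decide)) (G.nd 3 1 4 (by decide) (by decide) (by decide)) (G.nd 3 0 4 (by decide) (by decide) (by decide)) (G.nd 3 1 2 (by decide) (by decide) (by decide)) (by unfold orr; ring)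
    rw [bit_rot2 (z 0) (z 1) (z 3),
      bit_sw1 _ _ _ (G.nd 2 3 4 (by decide) (by decide) (by decide)),
      bit_rot2 (z 0) (z 2) (z 3),
      bit_sw1 _ _ _ (G.nd 1 3 4 (by decide) (by decide) (by decide)),
      bit_sw1 _ _ _ (G.nd 0 3 4 (by decide) (by decide) (by decide)),
      bit_rot2 (z 1) (z 2) (z 3)] at h
    exact h
  · have h := clg_of _ _ _ _ _ _ (G.nd 4 0 1 (by decide) (by decide) (by decide)) (G.nd 4 2 3 (by decide) (by decide) (by decide)) (G.nd 4 0 2 (by decide) (by decide) (by decide)) (G.nd 4 1 3 (by decide) (by decide) (by decide)) (G.nd 4 0 3 (by decide) (by decide) (by decide)) (G.nd 4 1 2 (by decide) (by decide) (by decide)) (by unfold orr; ring)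
    rw [bit_rot2 (z 0) (z 1) (z 4),
      bit_rot2 (z 2) (z 3) (z 4),
      bit_rot2 (z 0) (z 2) (z 4),
      bit_rot2 (z 1) (z 3) (z 4),
      bit_rot2 (z 0) (z 3) (z 4),
      bit_rot2 (z 1) (z 2) (z 4)] at h
    exact h
  · have h := G.nohull 0 1 2 3 4 (by decide) h01
    exact h
  · have h := G.nocross 0 1 2 3 (by decide) h01
    rw [bit_rot (z 0) (z 2) (z 3),
      bit_rot (z 1) (z 2) (z 3)] at h
    exact h
  · have h := G.nocross 0 1 2 4 (by decide) h01
    rw [bit_rot (z 0) (z 2) (z 4),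
      bit_rot (z 1) (z 2) (z 4)] at h
    exact h
  · have h := G.nocross 0 1 3 4 (by decide) h01
    rw [bit_rot (z 0) (z 3) (z 4),
      bit_rot (z 1) (z 3) (z 4)] at h
    exact h
  · have h := G.nohull 1 2 0 3 4 (by decide) h12
    rw [bit_rot (z 0) (z 1) (z 2)] at h
    exact h
  · have h := G.nocross 1 2 0 3 (by decide) h12
    rw [bit_rot (z 0) (z 1) (z 2),
      bit_sw2 _ _ _ (G.nd 0 1 3 (by decide) (by decide) (by decide)),
      bit_sw2 _ _ _ (G.nd 0 2 3 (by decide) (by decide) (by decide))] at h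
    exact h
  · have h := G.nocross 1 2 0 4 (by decide) h12
    rw [bit_rot (z 0) (z 1) (z 2),
      bit_sw2 _ _ _ (G.nd 0 1 4 (by decide) (by decide) (by decide)),
      bit_sw2 _ _ _ (G.nd 0 2 4 (by decide) (by decide) (by decide))] at h
    exact h
  · have h := G.nocross 1 2 3 4 (by decide) h12
    rw [bit_rot (z 1) (z 3) (z 4),
      bit_rot (z 2) (z 3) (z 4)] at h
    exact h
  · have h := G.nohull 1 3 0 2 4 (by decide) h13
    rw [bit_rot (z 0) (z 1) (z 3),
      bit_sw2 _ _ _ (G.nd 1 2 3 (by decide) (by decide) (by decide))] at h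
    exact h
  · have h := G.nocross 1 3 0 2 (by decide) h13
    rw [bit_rot (z 0) (z 1) (z 3),
      bit_sw2 _ _ _ (G.nd 1 2 3 (by decide) (by decide) (by decide)),
      bit_sw2 _ _ _ (G.nd 0 1 2 (by decide) (by decide) (by decide))] at h
    exact h
  · have h := G.nocross 1 3 0 4 (by decide) h13
    rw [bit_rot (z 0) (z 1) (z 3),
      bit_sw2 _ _ _ (G.nd 0 1 4 (by decide) (by decide) (by decide)),
      bit_sw2 _ _ _ (G.nd 0 3 4 (by decide) (by decide) (by decide))] at h
    exact h
  · have h := G.nocross 1 3 2 4 (by decide) h13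
    rw [bit_sw2 _ _ _ (G.nd 1 2 3 (by decide) (by decide) (by decide)),
      bit_rot (z 1) (z 2) (z 4),
      bit_sw2 _ _ _ (G.nd 2 3 4 (by decide) (by decide) (by decide))] at h
    exact h
  · have h := G.nohull 1 4 0 2 3 (by decide) h14
    rw [bit_rot (z 0) (z 1) (z 4),
      bit_sw2 _ _ _ (G.nd 1 2 4 (by decide) (by decide) (by decide)),
      bit_sw2 _ _ _ (G.nd 1 3 4 (by decide) (by decide) (by decide))] at h
    exact h
  · have h := G.nocross 1 4 0 2 (by decide) h14
    rw [bit_rot (z 0) (z 1) (z 4),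
      bit_sw2 _ _ _ (G.nd 1 2 4 (by decide) (by decide) (by decide)),
      bit_sw2 _ _ _ (G.nd 0 1 2 (by decide) (by decide) (by decide))] at h
    exact h
  · have h := G.nocross 1 4 0 3 (by decide) h14
    rw [bit_rot (z 0) (z 1) (z 4),
      bit_sw2 _ _ _ (G.nd 1 3 4 (by decide) (by decide) (by decide)),
      bit_sw2 _ _ _ (G.nd 0 1 3 (by decide) (by decide) (by decide))] at h
    exact h
  · have h := G.nocross 1 4 2 3 (by decide) h14
    rw [bit_sw2 _ _ _ (G.nd 1 2 4 (by decide) (by decide) (by decide)),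
      bit_sw2 _ _ _ (G.nd 1 3 4 (by decide) (by decide) (by decide)),
      bit_rot (z 1) (z 2) (z 3)] at h
    exact h

set_option synthInstance.maxHeartbeats 400000 in
set_option synthInstance.maxSize 4000 in
lemma bool_C4 : ∀ x012 x013 x014 x023 x024 x034 x123 x124 x134 x234 : Bool,
    cl4 x123 x023 x013 x012 = true →
    cl4 x124 x024 x014 x012 = true →
    cl4 x134 x034 x014 x013 = true →
    cl4 x234 x034 x024 x023 = true →
    cl4 x234 x134 x124 x123 = true →
    clg x012 x034 x013 x024 x014 x023 = true →
    clg (!x012) x134 (!x013) x124 (!x014) x123 = true →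
    clg x012 x234 (!x023) (!x124) (!x024) (!x123) = true →
    clg x013 (!x234) x023 (!x134) (!x034) x123 = true →
    clg x014 x234 x024 x134 x034 x124 = true →
    clh x012 x013 x014 = true →
    clx x012 x013 x023 x123 = true →
    clx x012 x014 x024 x124 = true →
    clx x013 x014 x034 x134 = true →
    clh x012 x123 x124 = true →
    clx x012 x123 (!x013) (!x023) = true →
    clx x012 x124 (!x014) (!x024) = true →
    clx x123 x124 x134 x234 = true →
    clh x023 x123 x234 = true →
    clx x023 x123 x012 x013 = true →
    clx x023 x234 (!x024) (!x034) = true →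
    clx x123 x234 (!x124) (!x134) = true →
    clh (!x013) (!x023) x034 = true →
    clx (!x013) (!x023) x012 x123 = true →
    clx (!x013) x034 x014 (!x134) = true →
    clx (!x023) x034 x024 (!x234) = true → False := by
  decide +kernel

lemma Good.no_C4 {z : Fin 5 → ℂ} {E : Fin 5 → Fin 5 → ℤ} (G : Good z E)
    (h01 : Bad E 0 1)
    (h12 : Bad E 1 2)
    (h23 : Bad E 2 3)
    (h03 : Bad E 0 3) : False := by
  refine bool_C4 (bit (orr (z 0) (z 1) (z 2))) (bit (orr (z 0) (z 1) (z 3))) (bit (orr (z 0) (z 1) (z 4))) (bit (orr (z 0) (z 2) (z 3))) (bit (orr (z 0) (z 2) (z 4))) (bit (orr (z 0) (z 3) (z 4))) (bit (orr (z 1) (z 2) (z 3))) (bit (orr (z 1) (z 2) (z 4))) (bit (orr (z 1) (z 3) (z 4))) (bit (orr (z 2) (z 3) (z 4)))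
    ?_ ?_ ?_ ?_ ?_ ?_ ?_ ?_ ?_ ?_ ?_ ?_ ?_ ?_ ?_ ?_ ?_ ?_ ?_ ?_ ?_ ?_ ?_ ?_ ?_ ?_
  · have h := cl4_of _ _ _ _ (G.nd 1 2 3 (by decide) (by decide) (by decide)) (G.nd 0 2 3 (by decide) (by decide) (by decide)) (G.nd 0 1 3 (by decide) (by decide) (by decide)) (G.nd 0 1 2 (by decide) (by decide) (by decide)) (by unfold orr; ring)
    exact h
  · have h := cl4_of _ _ _ _ (G.nd 1 2 4 (by decide) (by decide) (by decide)) (G.nd 0 2 4 (by decide) (by decide) (by decide)) (G.nd 0 1 4 (by decide) (by decide) (by decide)) (G.nd 0 1 2 (by decide) (by decide) (by decide)) (by unfold orr; ring)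
    exact h
  · have h := cl4_of _ _ _ _ (G.nd 1 3 4 (by decide) (by decide) (by decide)) (G.nd 0 3 4 (by decide) (by decide) (by decide)) (G.nd 0 1 4 (by decide) (by decide) (by decide)) (G.nd 0 1 3 (by decide) (by decide) (by decide)) (by unfold orr; ring)
    exact h
  · have h := cl4_of _ _ _ _ (G.nd 2 3 4 (by decide) (by decide) (by decide)) (G.nd 0 3 4 (by decide) (by decide) (by decide)) (G.nd 0 2 4 (by decide) (by decide) (by decide)) (G.nd 0 2 3 (by decide) (by decide) (by decide)) (by unfold orr; ring)
    exact h
  · have h := cl4_of _ _ _ _ (G.nd 2 3 4 (by decide) (by decide) (by decide)) (G.nd 1 3 4 (by decide) (by decide) (by decide)) (G.nd 1 2 4 (by decide) (by decide) (by decide)) (G.nd 1 2 3 (by decide) (by decide) (by decide)) (by unfold orr; ring)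
    exact h
  · have h := clg_of _ _ _ _ _ _ (G.nd 0 1 2 (by decide) (by decide) (by decide)) (G.nd 0 3 4 (by decide) (by decide) (by decide)) (G.nd 0 1 3 (by decide) (by decide) (by decide)) (G.nd 0 2 4 (by decide) (by decide) (by decide)) (G.nd 0 1 4 (by decide) (by decide) (by decide)) (G.nd 0 2 3 (by decide) (by decide) (by decide)) (by unfold orr; ring)
    exact h
  · have h := clg_of _ _ _ _ _ _ (G.nd 1 0 2 (by decide) (by decide) (by decide)) (G.nd 1 3 4 (by decide) (by decide) (by decide)) (G.nd 1 0 3 (by decide) (by decide) (by decide)) (G.nd 1 2 4 (by decide) (by decide) (by decide)) (G.nd 1 0 4 (by decide) (by decide) (by decide)) (G.nd 1 2 3 (by decide) (by decide) (by decide)) (by unfold orr; ring)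
    rw [bit_sw1 _ _ _ (G.nd 0 1 2 (by decide) (by decide) (by decide)),
      bit_sw1 _ _ _ (G.nd 0 1 3 (by decide) (by decide) (by decide)),
      bit_sw1 _ _ _ (G.nd 0 1 4 (by decide) (by decide) (by decide))] at h
    exact h
  · have h := clg_of _ _ _ _ _ _ (G.nd 2 0 1 (by decide) (by decide) (by decide)) (G.nd 2 3 4 (by decide) (by decide) (by decide)) (G.nd 2 0 3 (by decide) (by decide) (by decide)) (G.nd 2 1 4 (by decide) (by decide) (by decide)) (G.nd 2 0 4 (by decide) (by decide) (by decide)) (G.nd 2 1 3 (by decide) (by decide) (by decide)) (by unfold orr; ring)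
    rw [bit_rot2 (z 0) (z 1) (z 2),
      bit_sw1 _ _ _ (G.nd 0 2 3 (by decide) (by decide) (by decide)),
      bit_sw1 _ _ _ (G.nd 1 2 4 (by decide) (by decide) (by decide)),
      bit_sw1 _ _ _ (G.nd 0 2 4 (by decide) (by decide) (by decide)),
      bit_sw1 _ _ _ (G.nd 1 2 3 (by decide) (by decide) (by decide))] at h
    exact h
  · have h := clg_of _ _ _ _ _ _ (G.nd 3 0 1 (by decide) (by decide) (by decide)) (G.nd 3 2 4 (by decide) (by decide) (by decide)) (G.nd 3 0 2 (by decide) (by decide) (by decide)) (G.nd 3 1 4 (by decide) (by decide) (by decide)) (G.nd 3 0 4 (by decide) (by decide) (by decide)) (G.nd 3 1 2 (by decide) (by decide) (by decide)) (by unfold orr; ring)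
    rw [bit_rot2 (z 0) (z 1) (z 3),
      bit_sw1 _ _ _ (G.nd 2 3 4 (by decide) (by decide) (by decide)),
      bit_rot2 (z 0) (z 2) (z 3),
      bit_sw1 _ _ _ (G.nd 1 3 4 (by decide) (by decide) (by decide)),
      bit_sw1 _ _ _ (G.nd 0 3 4 (by decide) (by decide) (by decide)),
      bit_rot2 (z 1) (z 2) (z 3)] at h
    exact h
  · have h := clg_of _ _ _ _ _ _ (G.nd 4 0 1 (by decide) (by decide) (by decide)) (G.nd 4 2 3 (by decide) (by decide) (by decide)) (G.nd 4 0 2 (by decide) (by decide) (by decide)) (G.nd 4 1 3 (by decide) (by decide) (by decide)) (G.nd 4 0 3 (by decide) (by decide) (by decide)) (G.nd 4 1 2 (by decide) (by decide) (by decide)) (by unfold orr; ring)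
    rw [bit_rot2 (z 0) (z 1) (z 4),
      bit_rot2 (z 2) (z 3) (z 4),
      bit_rot2 (z 0) (z 2) (z 4),
      bit_rot2 (z 1) (z 3) (z 4),
      bit_rot2 (z 0) (z 3) (z 4),
      bit_rot2 (z 1) (z 2) (z 4)] at h
    exact h
  · have h := G.nohull 0 1 2 3 4 (by decide) h01
    exact h
  · have h := G.nocross 0 1 2 3 (by decide) h01
    rw [bit_rot (z 0) (z 2) (z 3),
      bit_rot (z 1) (z 2) (z 3)] at h
    exact h
  · have h := G.nocross 0 1 2 4 (by decide) h01
    rw [bit_rot (z 0) (z 2) (z 4),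
      bit_rot (z 1) (z 2) (z 4)] at h
    exact h
  · have h := G.nocross 0 1 3 4 (by decide) h01
    rw [bit_rot (z 0) (z 3) (z 4),
      bit_rot (z 1) (z 3) (z 4)] at h
    exact h
  · have h := G.nohull 1 2 0 3 4 (by decide) h12
    rw [bit_rot (z 0) (z 1) (z 2)] at h
    exact h
  · have h := G.nocross 1 2 0 3 (by decide) h12
    rw [bit_rot (z 0) (z 1) (z 2),
      bit_sw2 _ _ _ (G.nd 0 1 3 (by decide) (by decide) (by decide)),
      bit_sw2 _ _ _ (G.nd 0 2 3 (by decide) (by decide) (by decide))] at h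
    exact h
  · have h := G.nocross 1 2 0 4 (by decide) h12
    rw [bit_rot (z 0) (z 1) (z 2),
      bit_sw2 _ _ _ (G.nd 0 1 4 (by decide) (by decide) (by decide)),
      bit_sw2 _ _ _ (G.nd 0 2 4 (by decide) (by decide) (by decide))] at h
    exact h
  · have h := G.nocross 1 2 3 4 (by decide) h12
    rw [bit_rot (z 1) (z 3) (z 4),
      bit_rot (z 2) (z 3) (z 4)] at h
    exact h
  · have h := G.nohull 2 3 0 1 4 (by decide) h23
    rw [bit_rot (z 0) (z 2) (z 3),
      bit_rot (z 1) (z 2) (z 3)] at h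
    exact h
  · have h := G.nocross 2 3 0 1 (by decide) h23
    rw [bit_rot (z 0) (z 2) (z 3),
      bit_rot (z 1) (z 2) (z 3)] at h
    exact h
  · have h := G.nocross 2 3 0 4 (by decide) h23
    rw [bit_rot (z 0) (z 2) (z 3),
      bit_sw2 _ _ _ (G.nd 0 2 4 (by decide) (by decide) (by decide)),
      bit_sw2 _ _ _ (G.nd 0 3 4 (by decide) (by decide) (by decide))] at h
    exact h
  · have h := G.nocross 2 3 1 4 (by decide) h23
    rw [bit_rot (z 1) (z 2) (z 3),
      bit_sw2 _ _ _ (G.nd 1 2 4 (by decide) (by decide) (by decide)),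
      bit_sw2 _ _ _ (G.nd 1 3 4 (by decide) (by decide) (by decide))] at h
    exact h
  · have h := G.nohull 0 3 1 2 4 (by decide) h03
    rw [bit_sw2 _ _ _ (G.nd 0 1 3 (by decide) (by decide) (by decide)),
      bit_sw2 _ _ _ (G.nd 0 2 3 (by decide) (by decide) (by decide))] at h
    exact h
  · have h := G.nocross 0 3 1 2 (by decide) h03
    rw [bit_sw2 _ _ _ (G.nd 0 1 3 (by decide) (by decide) (by decide)),
      bit_sw2 _ _ _ (G.nd 0 2 3 (by decide) (by decide) (by decide)),
      bit_rot (z 0) (z 1) (z 2)] at h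
    exact h
  · have h := G.nocross 0 3 1 4 (by decide) h03
    rw [bit_sw2 _ _ _ (G.nd 0 1 3 (by decide) (by decide) (by decide)),
      bit_rot (z 0) (z 1) (z 4),
      bit_sw2 _ _ _ (G.nd 1 3 4 (by decide) (by decide) (by decide))] at h
    exact h
  · have h := G.nocross 0 3 2 4 (by decide) h03
    rw [bit_sw2 _ _ _ (G.nd 0 2 3 (by decide) (by decide) (by decide)),
      bit_rot (z 0) (z 2) (z 4),
      bit_sw2 _ _ _ (G.nd 2 3 4 (by decide) (by decide) (by decide))] at h
    exact h

set_option synthInstance.maxHeartbeats 400000 in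
set_option synthInstance.maxSize 4000 in
lemma bool_C5 : ∀ x012 x013 x014 x023 x024 x034 x123 x124 x134 x234 : Bool,
    cl4 x123 x023 x013 x012 = true →
    cl4 x124 x024 x014 x012 = true →
    cl4 x134 x034 x014 x013 = true →
    cl4 x234 x034 x024 x023 = true →
    cl4 x234 x134 x124 x123 = true →
    clg x012 x034 x013 x024 x014 x023 = true →
    clg (!x012) x134 (!x013) x124 (!x014) x123 = true →
    clg x012 x234 (!x023) (!x124) (!x024) (!x123) = true →
    clg x013 (!x234) x023 (!x134) (!x034) x123 = true →
    clg x014 x234 x024 x134 x034 x124 = true →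
    clh x012 x013 x014 = true →
    clx x012 x013 x023 x123 = true →
    clx x012 x014 x024 x124 = true →
    clx x013 x014 x034 x134 = true →
    clh x012 x123 x124 = true →
    clx x012 x123 (!x013) (!x023) = true →
    clx x012 x124 (!x014) (!x024) = true →
    clx x123 x124 x134 x234 = true →
    clh x024 x124 (!x234) = true →
    clx x024 x124 x012 x014 = true →
    clx x024 (!x234) (!x023) x034 = true →
    clx x124 (!x234) (!x123) x134 = true →
    clh x034 x134 x234 = true →
    clx x034 x134 x013 x014 = true →
    clx x034 x234 x023 x024 = true →
    clx x134 x234 x123 x124 = true →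
    clh (!x013) (!x023) x034 = true →
    clx (!x013) (!x023) x012 x123 = true →
    clx (!x013) x034 x014 (!x134) = true →
    clx (!x023) x034 x024 (!x234) = true → False := by
  decide +kernel

lemma Good.no_C5 {z : Fin 5 → ℂ} {E : Fin 5 → Fin 5 → ℤ} (G : Good z E)
    (h01 : Bad E 0 1)
    (h12 : Bad E 1 2)
    (h24 : Bad E 2 4)
    (h34 : Bad E 3 4)
    (h03 : Bad E 0 3) : False := by
  refine bool_C5 (bit (orr (z 0) (z 1) (z 2))) (bit (orr (z 0) (z 1) (z 3))) (bit (orr (z 0) (z 1) (z 4))) (bit (orr (z 0) (z 2) (z 3))) (bit (orr (z 0) (z 2) (z 4))) (bit (orr (z 0) (z 3) (z 4))) (bit (orr (z 1) (z 2) (z 3))) (bit (orr (z 1) (z 2) (z 4))) (bit (orr (z 1) (z 3) (z 4))) (bit (orr (z 2) (z 3) (z 4)))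
    ?_ ?_ ?_ ?_ ?_ ?_ ?_ ?_ ?_ ?_ ?_ ?_ ?_ ?_ ?_ ?_ ?_ ?_ ?_ ?_ ?_ ?_ ?_ ?_ ?_ ?_ ?_ ?_ ?_ ?_
  · have h := cl4_of _ _ _ _ (G.nd 1 2 3 (by decide) (by decide) (by decide)) (G.nd 0 2 3 (by decide) (by decide) (by decide)) (G.nd 0 1 3 (by decide) (by decide) (by decide)) (G.nd 0 1 2 (by decide) (by decide) (by decide)) (by unfold orr; ring)
    exact h
  · have h := cl4_of _ _ _ _ (G.nd 1 2 4 (by decide) (by decide) (by decide)) (G.nd 0 2 4 (by decide) (by decide) (by decide)) (G.nd 0 1 4 (by decide) (by decide) (by decide)) (G.nd 0 1 2 (by decide) (by decide) (by decide)) (by unfold orr; ring)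
    exact h
  · have h := cl4_of _ _ _ _ (G.nd 1 3 4 (by decide) (by decide) (by decide)) (G.nd 0 3 4 (by decide) (by decide) (by decide)) (G.nd 0 1 4 (by decide) (by decide) (by decide)) (G.nd 0 1 3 (by decide) (by decide) (by decide)) (by unfold orr; ring)
    exact h
  · have h := cl4_of _ _ _ _ (G.nd 2 3 4 (by decide) (by decide) (by decide)) (G.nd 0 3 4 (by decide) (by decide) (by decide)) (G.nd 0 2 4 (by decide) (by decide) (by decide)) (G.nd 0 2 3 (by decide) (by decide) (by decide)) (by unfold orr; ring)
    exact h
  · have h := cl4_of _ _ _ _ (G.nd 2 3 4 (by decide) (by decide) (by decide)) (G.nd 1 3 4 (by decide) (by decide) (by decide)) (G.nd 1 2 4 (by decide) (by decide) (by decide)) (G.nd 1 2 3 (by decide) (by decide) (by decide)) (by unfold orr; ring)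
    exact h
  · have h := clg_of _ _ _ _ _ _ (G.nd 0 1 2 (by decide) (by decide) (by decide)) (G.nd 0 3 4 (by decide) (by decide) (by decide)) (G.nd 0 1 3 (by decide) (by decide) (by decide)) (G.nd 0 2 4 (by decide) (by decide) (by decide)) (G.nd 0 1 4 (by decide) (by decide) (by decide)) (G.nd 0 2 3 (by decide) (by decide) (by decide)) (by unfold orr; ring)
    exact h
  · have h := clg_of _ _ _ _ _ _ (G.nd 1 0 2 (by decide) (by decide) (by decide)) (G.nd 1 3 4 (by decide) (by decide) (by decide)) (G.nd 1 0 3 (by decide) (by decide) (by decide)) (G.nd 1 2 4 (by decide) (by decide) (by decide)) (G.nd 1 0 4 (by decide) (by decide) (by decide)) (G.nd 1 2 3 (by decide) (by decide) (by decide)) (by unfold orr; ring)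
    rw [bit_sw1 _ _ _ (G.nd 0 1 2 (by decide) (by decide) (by decide)),
      bit_sw1 _ _ _ (G.nd 0 1 3 (by decide) (by decide) (by decide)),
      bit_sw1 _ _ _ (G.nd 0 1 4 (by decide) (by decide) (by decide))] at h
    exact h
  · have h := clg_of _ _ _ _ _ _ (G.nd 2 0 1 (by decide) (by decide) (by decide)) (G.nd 2 3 4 (by decide) (by decide) (by decide)) (G.nd 2 0 3 (by decide) (by decide) (by decide)) (G.nd 2 1 4 (by decide) (by decide) (by decide)) (G.nd 2 0 4 (by decide) (by decide) (by decide)) (G.nd 2 1 3 (by decide) (by decide) (by decide)) (by unfold orr; ring)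
    rw [bit_rot2 (z 0) (z 1) (z 2),
      bit_sw1 _ _ _ (G.nd 0 2 3 (by decide) (by decide) (by decide)),
      bit_sw1 _ _ _ (G.nd 1 2 4 (by decide) (by decide) (by decide)),
      bit_sw1 _ _ _ (G.nd 0 2 4 (by decide) (by decide) (by decide)),
      bit_sw1 _ _ _ (G.nd 1 2 3 (by decide) (by decide) (by decide))] at h
    exact h
  · have h := clg_of _ _ _ _ _ _ (G.nd 3 0 1 (by decide) (by decide) (by decide)) (G.nd 3 2 4 (by decide) (by decide) (by decide)) (G.nd 3 0 2 (by decide) (by decide) (by decide)) (G.nd 3 1 4 (by decide) (by decide) (by decide)) (G.nd 3 0 4 (by decide) (by decide) (by decide)) (G.nd 3 1 2 (by decide) (by decide) (by decide)) (by unfold orr; ring)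
    rw [bit_rot2 (z 0) (z 1) (z 3),
      bit_sw1 _ _ _ (G.nd 2 3 4 (by decide) (by decide) (by decide)),
      bit_rot2 (z 0) (z 2) (z 3),
      bit_sw1 _ _ _ (G.nd 1 3 4 (by decide) (by decide) (by decide)),
      bit_sw1 _ _ _ (G.nd 0 3 4 (by decide) (by decide) (by decide)),
      bit_rot2 (z 1) (z 2) (z 3)] at h
    exact h
  · have h := clg_of _ _ _ _ _ _ (G.nd 4 0 1 (by decide) (by decide) (by decide)) (G.nd 4 2 3 (by decide) (by decide) (by decide)) (G.nd 4 0 2 (by decide) (by decide) (by decide)) (G.nd 4 1 3 (by decide) (by decide) (by decide)) (G.nd 4 0 3 (by decide) (by decide) (by decide)) (G.nd 4 1 2 (by decide) (by decide) (by decide)) (by unfold orr; ring)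
    rw [bit_rot2 (z 0) (z 1) (z 4),
      bit_rot2 (z 2) (z 3) (z 4),
      bit_rot2 (z 0) (z 2) (z 4),
      bit_rot2 (z 1) (z 3) (z 4),
      bit_rot2 (z 0) (z 3) (z 4),
      bit_rot2 (z 1) (z 2) (z 4)] at h
    exact h
  · have h := G.nohull 0 1 2 3 4 (by decide) h01
    exact h
  · have h := G.nocross 0 1 2 3 (by decide) h01
    rw [bit_rot (z 0) (z 2) (z 3),
      bit_rot (z 1) (z 2) (z 3)] at h
    exact h
  · have h := G.nocross 0 1 2 4 (by decide) h01
    rw [bit_rot (z 0) (z 2) (z 4),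
      bit_rot (z 1) (z 2) (z 4)] at h
    exact h
  · have h := G.nocross 0 1 3 4 (by decide) h01
    rw [bit_rot (z 0) (z 3) (z 4),
      bit_rot (z 1) (z 3) (z 4)] at h
    exact h
  · have h := G.nohull 1 2 0 3 4 (by decide) h12
    rw [bit_rot (z 0) (z 1) (z 2)] at h
    exact h
  · have h := G.nocross 1 2 0 3 (by decide) h12
    rw [bit_rot (z 0) (z 1) (z 2),
      bit_sw2 _ _ _ (G.nd 0 1 3 (by decide) (by decide) (by decide)),
      bit_sw2 _ _ _ (G.nd 0 2 3 (by decide) (by decide) (by decide))] at h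
    exact h
  · have h := G.nocross 1 2 0 4 (by decide) h12
    rw [bit_rot (z 0) (z 1) (z 2),
      bit_sw2 _ _ _ (G.nd 0 1 4 (by decide) (by decide) (by decide)),
      bit_sw2 _ _ _ (G.nd 0 2 4 (by decide) (by decide) (by decide))] at h
    exact h
  · have h := G.nocross 1 2 3 4 (by decide) h12
    rw [bit_rot (z 1) (z 3) (z 4),
      bit_rot (z 2) (z 3) (z 4)] at h
    exact h
  · have h := G.nohull 2 4 0 1 3 (by decide) h24
    rw [bit_rot (z 0) (z 2) (z 4),
      bit_rot (z 1) (z 2) (z 4),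
      bit_sw2 _ _ _ (G.nd 2 3 4 (by decide) (by decide) (by decide))] at h
    exact h
  · have h := G.nocross 2 4 0 1 (by decide) h24
    rw [bit_rot (z 0) (z 2) (z 4),
      bit_rot (z 1) (z 2) (z 4)] at h
    exact h
  · have h := G.nocross 2 4 0 3 (by decide) h24
    rw [bit_rot (z 0) (z 2) (z 4),
      bit_sw2 _ _ _ (G.nd 2 3 4 (by decide) (by decide) (by decide)),
      bit_sw2 _ _ _ (G.nd 0 2 3 (by decide) (by decide) (by decide))] at h
    exact h
  · have h := G.nocross 2 4 1 3 (by decide) h24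
    rw [bit_rot (z 1) (z 2) (z 4),
      bit_sw2 _ _ _ (G.nd 2 3 4 (by decide) (by decide) (by decide)),
      bit_sw2 _ _ _ (G.nd 1 2 3 (by decide) (by decide) (by decide))] at h
    exact h
  · have h := G.nohull 3 4 0 1 2 (by decide) h34
    rw [bit_rot (z 0) (z 3) (z 4),
      bit_rot (z 1) (z 3) (z 4),
      bit_rot (z 2) (z 3) (z 4)] at h
    exact h
  · have h := G.nocross 3 4 0 1 (by decide) h34
    rw [bit_rot (z 0) (z 3) (z 4),
      bit_rot (z 1) (z 3) (z 4)] at h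
    exact h
  · have h := G.nocross 3 4 0 2 (by decide) h34
    rw [bit_rot (z 0) (z 3) (z 4),
      bit_rot (z 2) (z 3) (z 4)] at h
    exact h
  · have h := G.nocross 3 4 1 2 (by decide) h34
    rw [bit_rot (z 1) (z 3) (z 4),
      bit_rot (z 2) (z 3) (z 4)] at h
    exact h
  · have h := G.nohull 0 3 1 2 4 (by decide) h03
    rw [bit_sw2 _ _ _ (G.nd 0 1 3 (by decide) (by decide) (by decide)),
      bit_sw2 _ _ _ (G.nd 0 2 3 (by decide) (by decide) (by decide))] at h
    exact h
  · have h := G.nocross 0 3 1 2 (by decide) h03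
    rw [bit_sw2 _ _ _ (G.nd 0 1 3 (by decide) (by decide) (by decide)),
      bit_sw2 _ _ _ (G.nd 0 2 3 (by decide) (by decide) (by decide)),
      bit_rot (z 0) (z 1) (z 2)] at h
    exact h
  · have h := G.nocross 0 3 1 4 (by decide) h03
    rw [bit_sw2 _ _ _ (G.nd 0 1 3 (by decide) (by decide) (by decide)),
      bit_rot (z 0) (z 1) (z 4),
      bit_sw2 _ _ _ (G.nd 1 3 4 (by decide) (by decide) (by decide))] at h
    exact h
  · have h := G.nocross 0 3 2 4 (by decide) h03
    rw [bit_sw2 _ _ _ (G.nd 0 2 3 (by decide) (by decide) (by decide)),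
      bit_rot (z 0) (z 2) (z 4),
      bit_sw2 _ _ _ (G.nd 2 3 4 (by decide) (by decide) (by decide))] at h
    exact h

lemma tt_symm (a b : ℂ) : tt a b = tt b a := by
  unfold tt
  rw [← neg_sub b a, map_neg, neg_div_neg_eq]

lemma tt_self (a : ℂ) : tt a a = 0 := by simp [tt]

lemma tt_conj (a b : ℂ) (h : a ≠ b) : (starRingEnd ℂ) (tt a b) * tt a b = 1 := by
  have h1 : a - b ≠ 0 := sub_ne_zero.2 h
  have h2 : (starRingEnd ℂ) (a - b) ≠ 0 := (map_ne_zero _).2 h1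
  unfold tt
  rw [map_div₀, Complex.conj_conj]
  field_simp

lemma orr_ne (a b c : ℂ) (h : orr a b c ≠ 0) : a ≠ b ∧ a ≠ c ∧ b ≠ c := by
  refine ⟨?_, ?_, ?_⟩ <;> rintro rfl <;> apply h <;> unfold orr <;> ring

lemma tt_ne (a b c : ℂ) (h : orr a b c ≠ 0) : tt a b ≠ tt a c := by
  intro e
  obtain ⟨h1, h2, -⟩ := orr_ne a b c h
  have h1 := sub_ne_zero.2 h1
  have h2 := sub_ne_zero.2 h2
  unfold tt at e
  rw [div_eq_div_iff h1 h2] at e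
  have := congrArg Complex.im e
  simp at this
  apply h
  unfold orr
  linarith

lemma rect_aux (a b c d : ℂ) (ha : (starRingEnd ℂ) a * a = 1) (hb : (starRingEnd ℂ) b * b = 1)
    (hc : (starRingEnd ℂ) c * c = 1) (hd : (starRingEnd ℂ) d * d = 1) (h : a + b = c + d)
    (hac : a ≠ c) (had : a ≠ d) : a = -b := by
  have h' := congrArg (starRingEnd ℂ) h
  simp only [map_add] at h'
  have e : (a + b) * (c * d - a * b) = 0 := by
    linear_combination (a * b * c * d) * h' - (b * c * d) * ha - (a * c * d) * hb + (a * b * d) * hc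
      + (a * b * c) * hd - a * b * h
  rcases mul_eq_zero.1 e with e | e
  · linear_combination e
  · exfalso
    have : (a - c) * (a - d) = 0 := by linear_combination e + a * h
    rcases mul_eq_zero.1 this with e | e
    · exact hac (sub_eq_zero.1 e)
    · exact had (sub_eq_zero.1 e)

lemma nodup_cov : ∀ i j k l m : Fin 5, [i, j, k, l, m].Nodup → (i ≠ j ∧ i ≠ k ∧ i ≠ l ∧ i ≠ m ∧
    j ≠ k ∧ j ≠ l ∧ j ≠ m ∧ k ≠ l ∧ k ≠ m ∧ l ≠ m) ∧
    (Finset.univ : Finset (Fin 5)) = {i, j, k, l, m} := by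
  decide +kernel

lemma sum_labels {M : Type*} [AddCommMonoid M] (f : Fin 5 → M) (i j k l m : Fin 5)
    (hd : [i, j, k, l, m].Nodup) : ∑ x, f x = f i + (f j + (f k + (f l + f m))) := by
  obtain ⟨⟨h1, h2, h3, h4, h5, h6, h7, h8, h9, h10⟩, hu⟩ := nodup_cov i j k l m hd
  rw [hu, Finset.sum_insert (by simp [*]), Finset.sum_insert (by simp [*]),
    Finset.sum_insert (by simp [*]), Finset.sum_pair h10]

section
variable {z : Fin 5 → ℂ} {E : Fin 5 → Fin 5 → ℤ}

lemma Good.ne (G : Good z E) (i j k : Fin 5) (h1 : i ≠ j) (h2 : i ≠ k) (h3 : j ≠ k) :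
    z i ≠ z j := (orr_ne _ _ _ (G.nd i j k h1 h2 h3)).1

lemma Good.self (G : Good z E) (i : Fin 5) : E i i = 0 := by have := G.anti i i; omega

lemma Good.perm (G : Good z E) (p : Equiv.Perm (Fin 5)) :
    Good (fun i => z (p i)) (fun i j => E (p i) (p j)) where
  nd i j k h1 h2 h3 := G.nd _ _ _ (p.injective.ne h1) (p.injective.ne h2) (p.injective.ne h3)
  anti i j := G.anti _ _
  val i j h := G.val _ _ (p.injective.ne h)
  sum i := by rw [Equiv.sum_comp p (fun j => E (p i) j)]; exact G.sum _
  tsum i := by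
    rw [Equiv.sum_comp p (fun j => (E (p i) j : ℂ) * tt (z (p i)) (z j))]; exact G.tsum _
  hull i j h hk := by
    apply G.hull _ _ (p.injective.ne h)
    intro k h1 h2
    have := hk (p.symm k) (by rintro rfl; simp at h1) (by rintro rfl; simp at h2)
    simpa using this
  cross i j k l h := by
    apply G.cross
    have := h.map p.injective
    simpa using this

lemma Good.rect (G : Good z E) (i j k l m : Fin 5) (hd : [i, j, k, l, m].Nodup)
    (hk : E i k = E i j) (hl : E i l = - E i j) (hm : E i m = - E i j) :
    tt (z i) (z j) = - tt (z i) (z k) := by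
  obtain ⟨⟨h1, h2, h3, h4, h5, h6, h7, h8, h9, h10⟩, -⟩ := nodup_cov i j k l m hd
  have hs := G.tsum i
  rw [sum_labels _ i j k l m hd, hk, hl, hm, G.self] at hs
  have hE : (E i j : ℂ) ≠ 0 := by
    have := G.val i j h1
    have h0 : E i j ≠ 0 := by omega
    exact_mod_cast h0
  push_cast at hs
  have e : (E i j : ℂ) * ((tt (z i) (z j) + tt (z i) (z k)) - (tt (z i) (z l) + tt (z i) (z m)))
      = 0 := by linear_combination hs
  rcases mul_eq_zero.1 e with e | e
  · contradiction
  · exact rect_aux _ _ _ _ (tt_conj _ _ (G.ne i j k h1 h2 h5)) (tt_conj _ _ (G.ne i k j h2 h1 h5.symm))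
      (tt_conj _ _ (G.ne i l j h3 h1 h6.symm)) (tt_conj _ _ (G.ne i m j h4 h1 h7.symm))
      (sub_eq_zero.1 e) (tt_ne _ _ _ (G.nd i j l h1 h3 h6)) (tt_ne _ _ _ (G.nd i j m h1 h4 h7))

lemma Bad.symm' (G : Good z E) (i j : Fin 5) : Bad E i j ↔ Bad E j i := by
  have := G.anti i j
  unfold Bad
  omega

lemma Good.par (G : Good z E) (i j k l m : Fin 5) (hd : [i, j, k, l, m].Nodup) :
    (Bad E i j ↔ Bad E i k) ↔ (Bad E i l ↔ Bad E i m) := by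
  obtain ⟨⟨h1, h2, h3, h4, -⟩, -⟩ := nodup_cov i j k l m hd
  have hs := G.sum i
  rw [sum_labels _ i j k l m hd, G.self] at hs
  have key : ∀ j, i ≠ j → (Bad E i j ↔ E i j % 2 = 0) := by
    intro j hj
    have := G.val i j hj
    unfold Bad
    omega
  rw [key j h1, key k h2, key l h3, key m h4]
  omega

lemma Good.one (G : Good z E) (i j : Fin 5) (h : i ≠ j) (hb : ¬ Bad E i j) :
    E i j = 1 ∨ E i j = -1 := by
  have := G.val i j h
  unfold Bad at hb
  omega

/-- excluding the triangle of bad edges -/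
lemma Good.no_tri (G : Good z E) (h01 : Bad E 0 1) (h12 : Bad E 1 2) (h02 : Bad E 0 2)
    (h03 : ¬ Bad E 0 3) (h04 : ¬ Bad E 0 4) (h13 : ¬ Bad E 1 3) (h14 : ¬ Bad E 1 4)
    (h23 : ¬ Bad E 2 3) (h24 : ¬ Bad E 2 4) (h34 : ¬ Bad E 3 4) : False := by
  have a01 := G.anti 1 0
  have a02 := G.anti 2 0
  have a12 := G.anti 2 1
  have a03 := G.anti 3 0
  have a04 := G.anti 4 0
  have a13 := G.anti 3 1
  have a14 := G.anti 4 1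
  have a23 := G.anti 3 2
  have a24 := G.anti 4 2
  have a34 := G.anti 4 3
  have s0 := G.sum 0
  have s1 := G.sum 1
  have s2 := G.sum 2
  have s3 := G.sum 3
  have s4 := G.sum 4
  simp only [Fin.sum_univ_five, G.self] at s0 s1 s2 s3 s4
  replace h03 := G.one 0 3 (by decide) h03
  replace h04 := G.one 0 4 (by decide) h04
  replace h13 := G.one 1 3 (by decide) h13
  replace h14 := G.one 1 4 (by decide) h14
  replace h23 := G.one 2 3 (by decide) h23
  replace h24 := G.one 2 4 (by decide) h24
  replace h34 := G.one 3 4 (by decide) h34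
  unfold Bad at *
  have e0 : E 0 4 = - E 0 3 := by omega
  have e1 : E 1 4 = - E 1 3 := by omega
  have e2 : E 2 4 = - E 2 3 := by omega
  have key : ∀ m : Fin 5, tt (z 3) (z 4) = - tt (z 3) (z m) → tt (z 4) (z 3) = - tt (z 4) (z m) →
      m ≠ 3 → m ≠ 4 → False := by
    intro m k1 k2 n1 n2
    apply tt_ne _ _ _ (G.nd m 3 4 n1 n2 (by decide))
    rw [tt_symm, tt_symm (z m)]
    rw [tt_symm (z 4) (z 3)] at k2
    linear_combination k1 - k2
  have hc : (E 3 4 = E 3 0 ∧ E 3 1 = - E 3 4 ∧ E 3 2 = - E 3 4) ∨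
      (E 3 4 = E 3 1 ∧ E 3 0 = - E 3 4 ∧ E 3 2 = - E 3 4) ∨
      (E 3 4 = E 3 2 ∧ E 3 0 = - E 3 4 ∧ E 3 1 = - E 3 4) := by omega
  rcases hc with ⟨c1, c2, c3⟩ | ⟨c1, c2, c3⟩ | ⟨c1, c2, c3⟩
  · exact key 0 (G.rect 3 4 0 1 2 (by decide) (by omega) (by omega) (by omega))
      (G.rect 4 3 0 1 2 (by decide) (by omega) (by omega) (by omega)) (by decide) (by decide)
  · exact key 1 (G.rect 3 4 1 0 2 (by decide) (by omega) (by omega) (by omega))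
      (G.rect 4 3 1 0 2 (by decide) (by omega) (by omega) (by omega)) (by decide) (by decide)
  · exact key 2 (G.rect 3 4 2 0 1 (by decide) (by omega) (by omega) (by omega))
      (G.rect 4 3 2 0 1 (by decide) (by omega) (by omega) (by omega)) (by decide) (by decide)

lemma Good.core1 (G : Good z E) (h01 : Bad E 0 1) (h12 : Bad E 1 2) : False := by
  have p0 := G.par 0 1 2 3 4 (by decide)
  have p1 := G.par 1 0 2 3 4 (by decide)
  have p2 := G.par 2 0 1 3 4 (by decide)
  have p3 := G.par 3 0 1 2 4 (by decide)
  have p4 := G.par 4 0 1 2 3 (by decide)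
  have st1 : Bad E 1 3 → Bad E 1 4 → False := fun a b => G.no_star h01 h12 a b
  have st0 : Bad E 0 2 → Bad E 0 3 → Bad E 0 4 → False := fun a b c =>
    (G.perm (Equiv.swap 0 1)).no_star ((Bad.symm' G 0 1).1 h01) a b c
  have st2 : Bad E 0 2 → Bad E 2 3 → Bad E 2 4 → False := fun a b c =>
    (G.perm (Equiv.swap 1 2)).no_star a ((Bad.symm' G 1 2).1 h12) b c
  have c4 : Bad E 2 3 → Bad E 0 3 → False := fun a b => G.no_C4 h01 h12 a b
  have c4' : Bad E 2 4 → Bad E 0 4 → False := fun a b =>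
    (G.perm (Equiv.swap 3 4)).no_C4 h01 h12 a b
  have c5 : Bad E 2 4 → Bad E 3 4 → Bad E 0 3 → False := fun a b c => G.no_C5 h01 h12 a b c
  have c5' : Bad E 2 3 → Bad E 3 4 → Bad E 0 4 → False := fun a b c =>
    (G.perm (Equiv.swap 3 4)).no_C5 h01 h12 a ((Bad.symm' G 3 4).1 b) c
  have tri := G.no_tri h01 h12
  rw [Bad.symm' G 1 0] at p1
  rw [Bad.symm' G 2 0, Bad.symm' G 2 1] at p2
  rw [Bad.symm' G 3 0, Bad.symm' G 3 1, Bad.symm' G 3 2] at p3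
  rw [Bad.symm' G 4 0, Bad.symm' G 4 1, Bad.symm' G 4 2, Bad.symm' G 4 3] at p4
  generalize Bad E 0 1 = b01 at *
  generalize Bad E 0 2 = b02 at *
  generalize Bad E 0 3 = b03 at *
  generalize Bad E 0 4 = b04 at *
  generalize Bad E 1 2 = b12 at *
  generalize Bad E 1 3 = b13 at *
  generalize Bad E 1 4 = b14 at *
  generalize Bad E 2 3 = b23 at *
  generalize Bad E 2 4 = b24 at *
  generalize Bad E 3 4 = b34 at *
  clear G
  grind

lemma Good.core0 (G : Good z E) (h01 : Bad E 0 1) : False := by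
  have p1 := G.par 1 0 2 3 4 (by decide)
  rw [Bad.symm' G 1 0] at p1
  have k2 : ¬ Bad E 1 2 := fun h => G.core1 h01 h
  have k3 : ¬ Bad E 1 3 := fun h => (G.perm (Equiv.swap 2 3)).core1 h01 h
  have k4 : ¬ Bad E 1 4 := fun h => (G.perm (Equiv.swap 2 4)).core1 h01 h
  tauto

lemma exists_perm3 : ∀ a b c : Fin 5, a ≠ b → a ≠ c → b ≠ c → ∃ p : Equiv.Perm (Fin 5),
    p 0 = a ∧ p 1 = b ∧ p 2 = c := by
  intro a b c h1 h2 h3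
  refine ⟨Equiv.swap 0 a * Equiv.swap 1 (Equiv.swap 0 a b) *
    Equiv.swap 2 (Equiv.swap 1 (Equiv.swap 0 a b) (Equiv.swap 0 a c)), ?_⟩
  revert a b c
  decide +kernel

lemma Good.no_bad (G : Good z E) (i j : Fin 5) (h : i ≠ j) : ¬ Bad E i j := by
  intro hb
  obtain ⟨k, h1, h2⟩ : ∃ k, i ≠ k ∧ j ≠ k := by clear hb h G; revert i j; decide
  obtain ⟨p, rfl, rfl, -⟩ := exists_perm3 i j k h h1 h2
  exact (G.perm p).core0 hb

lemma Good.tourn (G : Good z E) (h1 : E 0 1 = 1) (h2 : E 0 2 = 1) (h3 : E 1 2 = 1) : False := by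
  have v03 := G.one 0 3 (by decide) (G.no_bad 0 3 (by decide))
  have v04 := G.one 0 4 (by decide) (G.no_bad 0 4 (by decide))
  have v23 := G.one 2 3 (by decide) (G.no_bad 2 3 (by decide))
  have v24 := G.one 2 4 (by decide) (G.no_bad 2 4 (by decide))
  have s0 := G.sum 0
  have s2 := G.sum 2
  have a02 := G.anti 2 0
  have a12 := G.anti 2 1
  simp only [Fin.sum_univ_five, G.self] at s0 s2
  have r1 := G.rect 0 1 2 3 4 (by decide) (by omega) (by omega) (by omega)
  have r2 := G.rect 2 0 1 3 4 (by decide) (by omega) (by omega) (by omega)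
  apply tt_ne _ _ _ (G.nd 1 0 2 (by decide) (by decide) (by decide))
  rw [tt_symm, tt_symm (z 1)]
  rw [tt_symm (z 2) (z 0)] at r2
  linear_combination r1 - r2

lemma Good.false (G : Good z E) : False := by
  have one : ∀ i j, i ≠ j → E i j = 1 ∨ E i j = -1 := fun i j h => G.one i j h (G.no_bad i j h)
  have tr : ∀ a b c : Fin 5, a ≠ b → a ≠ c → b ≠ c → E a b = 1 → E a c = 1 → False := by
    intro a b c h1 h2 h3 e1 e2
    rcases one b c h3 with e3 | e3
    · obtain ⟨p, rfl, rfl, rfl⟩ := exists_perm3 a b c h1 h2 h3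
      exact (G.perm p).tourn e1 e2 e3
    · have := G.anti b c
      obtain ⟨p, rfl, rfl, rfl⟩ := exists_perm3 a c b h2 h1 h3.symm
      exact (G.perm p).tourn e2 e1 (by omega)
  have s0 := G.sum 0
  simp only [Fin.sum_univ_five, G.self] at s0
  have t12 := tr 0 1 2 (by decide) (by decide) (by decide)
  have t13 := tr 0 1 3 (by decide) (by decide) (by decide)
  have t14 := tr 0 1 4 (by decide) (by decide) (by decide)
  have t23 := tr 0 2 3 (by decide) (by decide) (by decide)
  have t24 := tr 0 2 4 (by decide) (by decide) (by decide)
  have t34 := tr 0 3 4 (by decide) (by decide) (by decide)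
  have o1 := one 0 1 (by decide)
  have o2 := one 0 2 (by decide)
  have o3 := one 0 3 (by decide)
  have o4 := one 0 4 (by decide)
  rcases o1 with o1 | o1 <;> rcases o2 with o2 | o2 <;> rcases o3 with o3 | o3 <;>
    rcases o4 with o4 | o4 <;> first | omega | tauto

end

lemma sym_sum {K : Type*} [CommRing K] (A : Fin 5 → Fin 5 → Fin 5 → K)
    (h1 : ∀ i j k, A j i k = A i j k) (h2 : ∀ i j k, A i k j = A i j k) (h0 : ∀ i k, A i i k = 0) :
    ∑ i, ∑ j, ∑ k, A i j k = 6 * (A 0 1 2 + A 0 1 3 + A 0 1 4 + A 0 2 3 + A 0 2 4 + A 0 3 4 +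
      A 1 2 3 + A 1 2 4 + A 1 3 4 + A 2 3 4) := by
  have p6 : ∀ a b c, A b a c = A a b c ∧ A a c b = A a b c ∧ A b c a = A a b c ∧
      A c a b = A a b c ∧ A c b a = A a b c := by
    intro a b c
    refine ⟨h1 a b c, h2 a b c, ?_, ?_, ?_⟩
    · rw [h2 b a c, h1]
    · rw [h1 a c b, h2]
    · rw [h2 c a b, h1 a c b, h2]
  have h0' : ∀ i k, A i k i = 0 := fun i k => by rw [h2, h0]
  have hzz : ∀ i k, A k i i = 0 := fun i k => by rw [h1 i k i, h0']
  simp only [Fin.sum_univ_five, h0, h0', hzz, p6 0 1 2, p6 0 1 3, p6 0 1 4, p6 0 2 3, p6 0 2 4,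
    p6 0 3 4, p6 1 2 3, p6 1 2 4, p6 1 3 4, p6 2 3 4]
  ring

noncomputable def ph (x y u : ℝ) : ℝ := (x + y + u + x * y * u) / 4

noncomputable def ss (z : Fin 5 → ℂ) (w : ℂ) (i j : Fin 5) : ℝ := Real.sign (orr (z i) (z j) w)

lemma ss_anti (z : Fin 5 → ℂ) (w : ℂ) (i j : Fin 5) : ss z w j i = - ss z w i j := by
  unfold ss
  rw [← Real.sign_neg]
  congr 1; unfold orr; ring

noncomputable def FF (D : Fin 5 → Fin 5 → Fin 5 → ℝ) (s : Fin 5 → Fin 5 → ℝ) : ℝ :=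
  ∑ i, ∑ j, ∑ k, D i j k * ph (s i j) (s j k) (s k i)

structure Pre (z : Fin 5 → ℂ) (D : Fin 5 → Fin 5 → Fin 5 → ℝ) : Prop where
  nd : ∀ i j k, i ≠ j → i ≠ k → j ≠ k → orr (z i) (z j) (z k) ≠ 0
  a1 : ∀ i j k, D j i k = - D i j k
  a2 : ∀ i j k, D i k j = - D i j k
  val : ∀ w, (∀ i j, i ≠ j → orr (z i) (z j) w ≠ 0) →
    FF D (ss z w) = -6 ∨ FF D (ss z w) = 0 ∨ FF D (ss z w) = 6
  mom : ∀ G : Polynomial ℂ, ∑ i, ∑ j, ∑ k, (D i j k : ℂ) * orr (z i) (z j) (z k) *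
    (G.eval (z i) / ((z i - z j) * (z i - z k))) = 0

section
variable {z : Fin 5 → ℂ} {D : Fin 5 → Fin 5 → Fin 5 → ℝ}

lemma sum3_comp {K : Type*} [AddCommMonoid K] (A : Fin 5 → Fin 5 → Fin 5 → K)
    (p : Equiv.Perm (Fin 5)) :
    ∑ i, ∑ j, ∑ k, A (p i) (p j) (p k) = ∑ i, ∑ j, ∑ k, A i j k := by
  rw [← Equiv.sum_comp p (fun i => ∑ j, ∑ k, A i j k)]
  refine Finset.sum_congr rfl fun i _ => ?_
  rw [← Equiv.sum_comp p (fun j => ∑ k, A (p i) j k)]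
  refine Finset.sum_congr rfl fun j _ => ?_
  rw [← Equiv.sum_comp p (fun k => A (p i) (p j) k)]

lemma Pre.perm (G : Pre z D) (p : Equiv.Perm (Fin 5)) :
    Pre (fun i => z (p i)) (fun i j k => D (p i) (p j) (p k)) where
  nd i j k h1 h2 h3 := G.nd _ _ _ (p.injective.ne h1) (p.injective.ne h2) (p.injective.ne h3)
  a1 i j k := G.a1 _ _ _
  a2 i j k := G.a2 _ _ _
  val w hw := by
    have := G.val w (by
      intro i j hij
      have := hw (p.symm i) (p.symm j) (p.symm.injective.ne hij)
      simpa using this)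
    have e := sum3_comp (fun i j k => D i j k * ph (ss z w i j) (ss z w j k) (ss z w k i)) p
    unfold FF at *
    rw [← e] at this
    exact this
  mom P := by
    have e := sum3_comp (fun i j k => (D i j k : ℂ) * orr (z i) (z j) (z k) *
      (P.eval (z i) / ((z i - z j) * (z i - z k)))) p
    rw [G.mom] at e
    exact e

lemma Pre.ten (a1 : ∀ i j k, D j i k = - D i j k) (a2 : ∀ i j k, D i k j = - D i j k)
    (s : Fin 5 → Fin 5 → ℝ) (hs : ∀ i j, s j i = - s i j) :
    FF D s = 6 * (
      D 0 1 2 * ph (s 0 1) (s 1 2) (-s 0 2) + D 0 1 3 * ph (s 0 1) (s 1 3) (-s 0 3) +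
      D 0 1 4 * ph (s 0 1) (s 1 4) (-s 0 4) + D 0 2 3 * ph (s 0 2) (s 2 3) (-s 0 3) +
      D 0 2 4 * ph (s 0 2) (s 2 4) (-s 0 4) + D 0 3 4 * ph (s 0 3) (s 3 4) (-s 0 4) +
      D 1 2 3 * ph (s 1 2) (s 2 3) (-s 1 3) + D 1 2 4 * ph (s 1 2) (s 2 4) (-s 1 4) +
      D 1 3 4 * ph (s 1 3) (s 3 4) (-s 1 4) + D 2 3 4 * ph (s 2 3) (s 3 4) (-s 2 4)) := by
  unfold FF
  rw [sym_sum]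
  · simp only [hs 0 2, hs 0 3, hs 0 4, hs 1 3, hs 1 4, hs 2 4]
  · intro i j k
    rw [a1 i j k, hs i j, hs k i, hs j k]
    unfold ph; ring
  · intro i j k
    rw [a2 i j k, hs k i, hs j k, hs i j]
    unfold ph; ring
  · intro i k
    have := a1 i i k
    rw [show D i i k = 0 by linarith, zero_mul]

noncomputable def EE (D : Fin 5 → Fin 5 → Fin 5 → ℝ) (i j : Fin 5) : ℝ := ∑ k, D i j k

lemma Pre.EE_anti (G : Pre z D) (i j : Fin 5) : EE D i j = - EE D j i := by
  unfold EE
  rw [← Finset.sum_neg_distrib]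
  exact Finset.sum_congr rfl fun k _ => G.a1 _ _ _

lemma Pre.EE_sum (G : Pre z D) (i : Fin 5) : ∑ j, EE D i j = 0 := by
  have h : ∑ j, EE D i j = - ∑ j, EE D i j := by
    unfold EE
    conv_lhs => rw [Finset.sum_comm]
    rw [← Finset.sum_neg_distrib]
    refine Finset.sum_congr rfl fun k _ => ?_
    rw [← Finset.sum_neg_distrib]
    exact Finset.sum_congr rfl fun j _ => G.a2 _ _ _
  linarith

lemma Pre.D0 (G : Pre z D) (i k : Fin 5) : D i i k = 0 ∧ D i k i = 0 ∧ D k i i = 0 := by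
  have h1 := G.a1 i i k
  have h2 := G.a2 i k i
  have h3 := G.a2 k i i
  refine ⟨by linarith, by linarith, by linarith⟩

lemma tt_orr (a b c : ℂ) (h1 : a ≠ b) (h2 : a ≠ c) :
    (orr a b c : ℂ) / ((a - b) * (a - c)) = (tt a b - tt a c) / (2 * Complex.I) := by
  have h1' := sub_ne_zero.2 h1
  have h2' := sub_ne_zero.2 h2
  have e : (orr a b c : ℂ) * (2 * Complex.I) =
      (starRingEnd ℂ) (a - b) * (a - c) - (a - b) * (starRingEnd ℂ) (a - c) := by
    apply Complex.ext <;> simp [orr] <;> ring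
  have hI : (2 * Complex.I) ≠ 0 := by simp
  unfold tt
  rw [div_eq_div_iff (mul_ne_zero h1' h2') hI, e]
  field_simp

lemma Pre.tsum (G : Pre z D) (i : Fin 5) : ∑ j, (EE D i j : ℂ) * tt (z i) (z j) = 0 := by
  have hne : ∀ i j, i ≠ j → z i ≠ z j := by
    intro i j h
    obtain ⟨k, h1, h2⟩ : ∃ k, i ≠ k ∧ j ≠ k := by clear G h; revert i j; decide
    exact (orr_ne _ _ _ (G.nd i j k h h1 h2)).1
  have h := G.mom (∏ j ∈ Finset.univ.erase i, (Polynomial.X - Polynomial.C (z j)))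
  rw [Finset.sum_eq_single i] at h
  rotate_left
  · intro b _ hb
    refine Finset.sum_eq_zero fun j _ => Finset.sum_eq_zero fun k _ => ?_
    rw [Polynomial.eval_prod, Finset.prod_eq_zero (i := b) (by simp [hb]) (by simp)]
    simp
  · simp
  set g := Polynomial.eval (z i) (∏ j ∈ Finset.univ.erase i, (Polynomial.X - Polynomial.C (z j)))
    with hg
  have hg0 : g ≠ 0 := by
    rw [hg, Polynomial.eval_prod, Finset.prod_ne_zero_iff]
    intro j hj
    simp only [Finset.mem_erase] at hj
    simpa [sub_eq_zero] using hne i j hj.1.symm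
  have e : ∀ j k, (D i j k : ℂ) * orr (z i) (z j) (z k) * (g / ((z i - z j) * (z i - z k))) =
      (D i j k * tt (z i) (z j) + D i k j * tt (z i) (z k)) * (g / (2 * Complex.I)) := by
    intro j k
    by_cases hj : i = j
    · subst hj; simp [(G.D0 i k).1, (G.D0 i k).2.1]
    by_cases hk : i = k
    · subst hk; simp [(G.D0 i j).1, (G.D0 i j).2.1]
    have := tt_orr _ _ _ (hne i j hj) (hne i k hk)
    rw [G.a2 i j k]
    push_cast
    linear_combination (D i j k : ℂ) * g * this
  simp_rw [e, ← Finset.sum_mul] at h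
  have hgI : g / (2 * Complex.I) ≠ 0 := div_ne_zero hg0 (by simp)
  replace h := (mul_eq_zero.1 h).resolve_right hgI
  simp_rw [Finset.sum_add_distrib] at h
  rw [Finset.sum_comm (f := fun j k => (D i k j : ℂ) * tt (z i) (z k))] at h
  have e2 : ∑ j, ∑ k, (D i j k : ℂ) * tt (z i) (z j) = ∑ j, (EE D i j : ℂ) * tt (z i) (z j) := by
    refine Finset.sum_congr rfl fun j _ => ?_
    unfold EE
    rw [Complex.ofReal_sum, Finset.sum_mul]
  rw [e2] at h
  linear_combination h / 2

lemma three_aux (x y u : ℝ) (a b c : ℂ) (ha : (starRingEnd ℂ) a * a = 1)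
    (hb : (starRingEnd ℂ) b * b = 1) (hc : (starRingEnd ℂ) c * c = 1)
    (h0 : x + y + u = 0) (h : x * a + y * b + u * c = 0) (hab : a ≠ b) (hac : a ≠ c)
    (hbc : b ≠ c) : x = 0 ∧ y = 0 ∧ u = 0 := by
  have h' := congrArg (starRingEnd ℂ) h
  simp only [map_add, map_mul, Complex.conj_ofReal, map_zero] at h'
  have h0' : (x : ℂ) + y + u = 0 := by exact_mod_cast h0
  have e : (u : ℂ) * ((c - a) * (c - b)) = 0 := by
    linear_combination (a*b*c)*h' - x*b*c*ha - y*a*c*hb - u*a*b*hc + c*h - (a*c+b*c)*h0'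
  have hu : (u : ℂ) = 0 := (mul_eq_zero.1 e).resolve_right
    (mul_ne_zero (sub_ne_zero.2 hac.symm) (sub_ne_zero.2 hbc.symm))
  have hx : (x : ℂ) = 0 := by
    have : (x : ℂ) * (a - b) = 0 := by linear_combination h - b * h0' + (b - c) * hu
    exact (mul_eq_zero.1 this).resolve_right (sub_ne_zero.2 hab)
  have hu' : u = 0 := by exact_mod_cast hu
  have hx' : x = 0 := by exact_mod_cast hx
  exact ⟨hx', by linarith, hu'⟩

lemma Pre.zero1 (G : Pre z D) (i j k l m : Fin 5) (hd : [i, j, k, l, m].Nodup)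
    (h : EE D i j = 0) : EE D i k = 0 ∧ EE D i l = 0 ∧ EE D i m = 0 := by
  have hs := G.EE_sum i
  have ht := G.tsum i
  obtain ⟨⟨d1, d2, d3, d4, d5, d6, d7, d8, d9, d10⟩, -⟩ := nodup_cov i j k l m hd
  rw [sum_labels _ i j k l m hd] at hs ht
  rw [tt_self, h] at ht
  have h0 : EE D i i = 0 := by have := G.EE_anti i i; linarith
  have n1 := G.nd i k l d2 d3 d8
  have n2 := G.nd i k m d2 d4 d9
  have n3 := G.nd i l m d3 d4 d10
  refine three_aux _ _ _ _ _ _ (tt_conj _ _ (orr_ne _ _ _ n1).1) (tt_conj _ _ (orr_ne _ _ _ n1).2.1)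
    (tt_conj _ _ (orr_ne _ _ _ n2).2.1) ?_ ?_ (tt_ne _ _ _ n1) (tt_ne _ _ _ n2) (tt_ne _ _ _ n3)
  · linarith
  · push_cast at ht
    linear_combination ht

lemma Pre.zero2 (G : Pre z D) (i j : Fin 5) (hij : i ≠ j) (h : EE D i j = 0) (k : Fin 5) :
    EE D i k = 0 := by
  obtain ⟨a, b, c, hd, hk⟩ : ∃ a b c : Fin 5, [i, j, a, b, c].Nodup ∧
      (k = i ∨ k = j ∨ k = a ∨ k = b ∨ k = c) := by
    clear h G; revert i j k; decide +kernel
  have := G.zero1 i j a b c hd h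
  have h0 : EE D i i = 0 := by have := G.EE_anti i i; linarith
  rcases hk with rfl | rfl | rfl | rfl | rfl
  exacts [h0, h, this.1, this.2.1, this.2.2]

lemma Pre.zero (G : Pre z D) (i j : Fin 5) (hij : i ≠ j) (h : EE D i j = 0) (a b : Fin 5) :
    EE D a b = 0 := by
  have h1 := G.zero2 i j hij h
  by_cases ha : a = i
  · subst ha; exact h1 b
  · refine G.zero2 a i ha ?_ b
    rw [G.EE_anti, h1]; simp

end

section
variable {z : Fin 5 → ℂ} {D : Fin 5 → Fin 5 → Fin 5 → ℝ}

lemma sign_mul_pos' {t : ℝ} (r : ℝ) (h : 0 < t) : Real.sign (t * r) = Real.sign r := by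
  rcases lt_trichotomy r 0 with h' | h' | h'
  · rw [Real.sign_of_neg h', Real.sign_of_neg (mul_neg_of_pos_of_neg h h')]
  · rw [h', mul_zero]
  · rw [Real.sign_of_pos h', Real.sign_of_pos (mul_pos h h')]

lemma ev_sign (a b x d : ℂ) (h : orr a b x ≠ 0) :
    ∀ᶠ e : ℝ in nhdsWithin 0 (Set.Ioi 0), Real.sign (orr a b (x + e * d)) = Real.sign (orr a b x) := by
  have hc : Continuous fun e : ℝ => orr a b (x + e * d) := by
    unfold orr; fun_prop
  have ht : Filter.Tendsto (fun e : ℝ => orr a b (x + e * d)) (nhdsWithin 0 (Set.Ioi 0))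
      (nhds (orr a b x)) := by
    have := hc.tendsto 0
    simp only [Complex.ofReal_zero, zero_mul, add_zero] at this
    exact this.mono_left nhdsWithin_le_nhds
  rcases lt_or_gt_of_ne h with h' | h'
  · filter_upwards [ht.eventually_lt_const h'] with e he
    rw [Real.sign_of_neg he, Real.sign_of_neg h']
  · filter_upwards [ht.eventually_const_lt h'] with e he
    rw [Real.sign_of_pos he, Real.sign_of_pos h']

def U (r : ℝ) : Prop := r = 1 ∨ r = -1

lemma U_sign {r : ℝ} (h : r ≠ 0) : U (Real.sign r) := by
  rcases lt_or_gt_of_ne h with h' | h'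
  · right; exact Real.sign_of_neg h'
  · left; exact Real.sign_of_pos h'

lemma U.ne {r : ℝ} (h : U r) : r ≠ 0 := by rcases h with h | h <;> rw [h] <;> norm_num

lemma U.sq {r : ℝ} (h : U r) : r ^ 2 = 1 := by rcases h with h | h <;> rw [h] <;> norm_num

noncomputable def TT (D : Fin 5 → Fin 5 → Fin 5 → ℝ)
    (s01 s02 s03 s04 s12 s13 s14 s23 s24 s34 : ℝ) : ℝ :=
  D 0 1 2 * ph s01 s12 (-s02) + D 0 1 3 * ph s01 s13 (-s03) +
  D 0 1 4 * ph s01 s14 (-s04) + D 0 2 3 * ph s02 s23 (-s03) +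
  D 0 2 4 * ph s02 s24 (-s04) + D 0 3 4 * ph s03 s34 (-s04) +
  D 1 2 3 * ph s12 s23 (-s13) + D 1 2 4 * ph s12 s24 (-s14) +
  D 1 3 4 * ph s13 s34 (-s14) + D 2 3 4 * ph s23 s34 (-s24)

lemma generic_of (w : ℂ) (h01 : ss z w 0 1 ≠ 0) (h02 : ss z w 0 2 ≠ 0) (h03 : ss z w 0 3 ≠ 0)
    (h04 : ss z w 0 4 ≠ 0) (h12 : ss z w 1 2 ≠ 0) (h13 : ss z w 1 3 ≠ 0) (h14 : ss z w 1 4 ≠ 0)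
    (h23 : ss z w 2 3 ≠ 0) (h24 : ss z w 2 4 ≠ 0) (h34 : ss z w 3 4 ≠ 0) :
    ∀ i j, i ≠ j → orr (z i) (z j) w ≠ 0 := by
  have key : ∀ i j, i < j → ss z w i j ≠ 0 := by
    intro i j hij
    fin_cases i <;> fin_cases j <;> first | assumption | (exfalso; revert hij; decide)
  intro i j hij h0
  rcases lt_or_gt_of_ne hij with h | h
  · exact key i j h (by unfold ss; rw [h0, Real.sign_zero])
  · refine key j i h (by rw [ss_anti]; unfold ss; rw [h0, Real.sign_zero, neg_zero])

lemma Pre.val10 (G : Pre z D) (w : ℂ) {s01 s02 s03 s04 s12 s13 s14 s23 s24 s34 : ℝ}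
    (h01 : ss z w 0 1 = s01) (h02 : ss z w 0 2 = s02) (h03 : ss z w 0 3 = s03)
    (h04 : ss z w 0 4 = s04) (h12 : ss z w 1 2 = s12) (h13 : ss z w 1 3 = s13)
    (h14 : ss z w 1 4 = s14) (h23 : ss z w 2 3 = s23) (h24 : ss z w 2 4 = s24)
    (h34 : ss z w 3 4 = s34) (k01 : s01 ≠ 0) (k02 : s02 ≠ 0) (k03 : s03 ≠ 0) (k04 : s04 ≠ 0)
    (k12 : s12 ≠ 0) (k13 : s13 ≠ 0) (k14 : s14 ≠ 0) (k23 : s23 ≠ 0) (k24 : s24 ≠ 0)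
    (k34 : s34 ≠ 0) :
    TT D s01 s02 s03 s04 s12 s13 s14 s23 s24 s34 = -1 ∨
    TT D s01 s02 s03 s04 s12 s13 s14 s23 s24 s34 = 0 ∨
    TT D s01 s02 s03 s04 s12 s13 s14 s23 s24 s34 = 1 := by
  have h := G.val w (generic_of w (h01 ▸ k01) (h02 ▸ k02) (h03 ▸ k03) (h04 ▸ k04) (h12 ▸ k12)
    (h13 ▸ k13) (h14 ▸ k14) (h23 ▸ k23) (h24 ▸ k24) (h34 ▸ k34))
  rw [Pre.ten G.a1 G.a2 _ (ss_anti z w), h01, h02, h03, h04, h12, h13, h14, h23, h24, h34] at h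
  unfold TT
  rcases h with h | h | h
  · left; linarith
  · right; left; linarith
  · right; right; linarith

lemma seg1 (a b k : ℂ) (t : ℝ) (h0 : 0 < t) :
    Real.sign (orr a k (a + t * (b - a))) = - Real.sign (orr a b k) := by
  rw [show orr a k (a + t * (b - a)) = t * (-orr a b k) by simp [orr]; ring, ← Real.sign_neg]
  exact sign_mul_pos' _ h0

lemma seg2 (a b k : ℂ) (t : ℝ) (h1 : t < 1) :
    Real.sign (orr b k (a + t * (b - a))) = Real.sign (orr a b k) := by
  rw [show orr b k (a + t * (b - a)) = (1 - t) * (orr a b k) by simp [orr]; ring]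
  exact sign_mul_pos' _ (by linarith)

lemma Pre.EE01 (G : Pre z D) : EE D 0 1 = D 0 1 2 + D 0 1 3 + D 0 1 4 := by
  unfold EE
  rw [Fin.sum_univ_five, (G.D0 0 1).2.1, (G.D0 1 0).2.2]; ring

lemma Pre.EE23 (G : Pre z D) : EE D 2 3 = D 0 2 3 + D 1 2 3 + D 2 3 4 := by
  unfold EE
  rw [Fin.sum_univ_five, (G.D0 2 3).2.1, (G.D0 3 2).2.2, G.a2 2 0 3, G.a1 0 2 3, G.a2 2 1 3,
    G.a1 1 2 3]; ring

lemma Pre.edge0 (G : Pre z D) : ∃ x : ℂ, ∃ t : ℝ, 0 < t ∧ t < 1 ∧ x = z 0 + t * (z 1 - z 0) ∧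
    orr (z 2) (z 3) x ≠ 0 ∧ orr (z 2) (z 4) x ≠ 0 ∧ orr (z 3) (z 4) x ≠ 0 := by
  have n23 : orr (z 2) (z 3) (z 0) ≠ 0 := G.nd _ _ _ (by decide) (by decide) (by decide)
  have n24 : orr (z 2) (z 4) (z 0) ≠ 0 := G.nd _ _ _ (by decide) (by decide) (by decide)
  have n34 : orr (z 3) (z 4) (z 0) ≠ 0 := G.nd _ _ _ (by decide) (by decide) (by decide)
  have hlt : ∀ᶠ e : ℝ in nhdsWithin 0 (Set.Ioi 0), e < 1 :=
    nhdsWithin_le_nhds (eventually_lt_nhds one_pos)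
  have hpos : ∀ᶠ e : ℝ in nhdsWithin 0 (Set.Ioi 0), 0 < e := self_mem_nhdsWithin
  obtain ⟨t, h0, h1, h2, h3, h4⟩ := (hpos.and (hlt.and ((ev_sign _ _ _ (z 1 - z 0) n23).and
    ((ev_sign _ _ _ (z 1 - z 0) n24).and (ev_sign _ _ _ (z 1 - z 0) n34))))).exists
  refine ⟨_, t, h0, h1, rfl, ?_, ?_, ?_⟩
  · intro h; rw [h, Real.sign_zero] at h2; exact (U_sign n23).ne h2.symm
  · intro h; rw [h, Real.sign_zero] at h3; exact (U_sign n24).ne h3.symm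
  · intro h; rw [h, Real.sign_zero] at h4; exact (U_sign n34).ne h4.symm

lemma Pre.edge (G : Pre z D) :
    (EE D 0 1 = 0 ∨ EE D 0 1 = 1 ∨ EE D 0 1 = -1 ∨ EE D 0 1 = 2 ∨ EE D 0 1 = -2) ∧
    (0 < orr (z 0) (z 1) (z 2) → 0 < orr (z 0) (z 1) (z 3) → 0 < orr (z 0) (z 1) (z 4) →
      EE D 0 1 = 0 ∨ EE D 0 1 = 1 ∨ EE D 0 1 = -1) := by
  obtain ⟨x, t, ht0, ht1, hx, n23, n24, n34⟩ := G.edge0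
  have n2 : orr (z 0) (z 1) (z 2) ≠ 0 := G.nd _ _ _ (by decide) (by decide) (by decide)
  have n3 : orr (z 0) (z 1) (z 3) ≠ 0 := G.nd _ _ _ (by decide) (by decide) (by decide)
  have n4 : orr (z 0) (z 1) (z 4) ≠ 0 := G.nd _ _ _ (by decide) (by decide) (by decide)
  have e0 : ∀ k, Real.sign (orr (z 0) (z k) x) = - Real.sign (orr (z 0) (z 1) (z k)) :=
    fun k => by rw [hx]; exact seg1 _ _ _ t ht0
  have e1 : ∀ k, Real.sign (orr (z 1) (z k) x) = Real.sign (orr (z 0) (z 1) (z k)) :=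
    fun k => by rw [hx]; exact seg2 _ _ _ t ht1
  have m0 : ∀ k, orr (z 0) (z 1) (z k) ≠ 0 → orr (z 0) (z k) x ≠ 0 := by
    intro k hk h; have := e0 k; rw [h, Real.sign_zero] at this; exact (U_sign hk).ne (by linarith)
  have m1 : ∀ k, orr (z 0) (z 1) (z k) ≠ 0 → orr (z 1) (z k) x ≠ 0 := by
    intro k hk h; have := e1 k; rw [h, Real.sign_zero] at this; exact (U_sign hk).ne (by linarith)
  have hpos : ∀ᶠ e : ℝ in nhdsWithin 0 (Set.Ioi 0), 0 < e := self_mem_nhdsWithin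
  have key : ∀ p : ℝ, U p → TT D p (-Real.sign (orr (z 0) (z 1) (z 2)))
      (-Real.sign (orr (z 0) (z 1) (z 3))) (-Real.sign (orr (z 0) (z 1) (z 4)))
      (Real.sign (orr (z 0) (z 1) (z 2))) (Real.sign (orr (z 0) (z 1) (z 3)))
      (Real.sign (orr (z 0) (z 1) (z 4))) (Real.sign (orr (z 2) (z 3) x))
      (Real.sign (orr (z 2) (z 4) x)) (Real.sign (orr (z 3) (z 4) x)) ∈ ({-1, 0, 1} : Set ℝ) := by
    intro p hp
    obtain ⟨e, he, h02, h03, h04, h12, h13, h14, h23, h24, h34⟩ :=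
      (hpos.and ((ev_sign _ _ _ (p * Complex.I * (z 1 - z 0)) (m0 2 n2)).and
      ((ev_sign _ _ _ (p * Complex.I * (z 1 - z 0)) (m0 3 n3)).and
      ((ev_sign _ _ _ (p * Complex.I * (z 1 - z 0)) (m0 4 n4)).and
      ((ev_sign _ _ _ (p * Complex.I * (z 1 - z 0)) (m1 2 n2)).and
      ((ev_sign _ _ _ (p * Complex.I * (z 1 - z 0)) (m1 3 n3)).and
      ((ev_sign _ _ _ (p * Complex.I * (z 1 - z 0)) (m1 4 n4)).and
      ((ev_sign _ _ _ (p * Complex.I * (z 1 - z 0)) n23).and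
      ((ev_sign _ _ _ (p * Complex.I * (z 1 - z 0)) n24).and
      ((ev_sign _ _ _ (p * Complex.I * (z 1 - z 0)) n34))))))))))).exists
    rw [e0] at h02 h03 h04
    rw [e1] at h12 h13 h14
    have h01 : Real.sign (orr (z 0) (z 1) (x + e * (p * Complex.I * (z 1 - z 0)))) = p := by
      have hne := (orr_ne _ _ _ n2).1
      have hN : 0 < ((z 1).re - (z 0).re) ^ 2 + ((z 1).im - (z 0).im) ^ 2 := by
        have : 0 < Complex.normSq (z 1 - z 0) := Complex.normSq_pos.2 (sub_ne_zero.2 hne.symm)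
        rw [Complex.normSq_apply] at this
        simp only [Complex.sub_re, Complex.sub_im] at this
        linarith
      have : orr (z 0) (z 1) (x + e * (p * Complex.I * (z 1 - z 0))) =
          (e * (((z 1).re - (z 0).re) ^ 2 + ((z 1).im - (z 0).im) ^ 2)) * p := by
        rw [hx]; simp [orr]; ring
      rw [this, sign_mul_pos' _ (mul_pos he hN)]
      rcases hp with h | h <;> rw [h]
      · exact Real.sign_one
      · rw [Real.sign_neg, Real.sign_one]
    have := G.val10 (x + e * (p * Complex.I * (z 1 - z 0))) h01 h02 h03 h04 h12 h13 h14 h23 h24 h34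
      hp.ne (neg_ne_zero.2 (U_sign n2).ne) (neg_ne_zero.2 (U_sign n3).ne)
      (neg_ne_zero.2 (U_sign n4).ne) (U_sign n2).ne (U_sign n3).ne (U_sign n4).ne
      (U_sign n23).ne (U_sign n24).ne (U_sign n34).ne
    simpa using this
  have k1 := key 1 (Or.inl rfl)
  have k2 := key (-1) (Or.inr rfl)
  have u2 := (U_sign n2).sq
  have u3 := (U_sign n3).sq
  have u4 := (U_sign n4).sq
  have u23 := U_sign n23
  have u24 := U_sign n24
  have u34 := U_sign n34
  have hgp : orr (z 2) (z 3) x * orr (z 0) (z 1) (z 4) + orr (z 3) (z 4) x * orr (z 0) (z 1) (z 2)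
      - orr (z 2) (z 4) x * orr (z 0) (z 1) (z 3) = 0 := by
    rw [hx]; simp [orr]; ring
  constructor
  · clear key hgp
    set σ2 := Real.sign (orr (z 0) (z 1) (z 2))
    set σ3 := Real.sign (orr (z 0) (z 1) (z 3))
    set σ4 := Real.sign (orr (z 0) (z 1) (z 4))
    have hdiff : ∀ a b c, TT D 1 (-σ2) (-σ3) (-σ4) σ2 σ3 σ4 a b c -
        TT D (-1) (-σ2) (-σ3) (-σ4) σ2 σ3 σ4 a b c = EE D 0 1 := by
      intro a b c
      rw [G.EE01]
      unfold TT ph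
      linear_combination D 0 1 2 / 2 * u2 + D 0 1 3 / 2 * u3 + D 0 1 4 / 2 * u4
    rw [← hdiff]
    simp only [Set.mem_insert_iff, Set.mem_singleton_iff] at k1 k2
    rcases k1 with k1 | k1 | k1 <;> rcases k2 with k2 | k2 | k2 <;> rw [k1, k2] <;> norm_num
  · intro p2 p3 p4
    clear key
    rw [Real.sign_of_pos p2, Real.sign_of_pos p3, Real.sign_of_pos p4] at k1 k2
    have hz : TT D (-1) (-1) (-1) (-1) 1 1 1 (Real.sign (orr (z 2) (z 3) x))
      (Real.sign (orr (z 2) (z 4) x)) (Real.sign (orr (z 3) (z 4) x)) = 0 := by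
      have h4 : ph (Real.sign (orr (z 2) (z 3) x)) (Real.sign (orr (z 3) (z 4) x))
          (-Real.sign (orr (z 2) (z 4) x)) = 0 := by
        unfold ph
        rcases lt_or_gt_of_ne n23 with h1 | h1 <;> rcases lt_or_gt_of_ne n24 with h2 | h2 <;>
          rcases lt_or_gt_of_ne n34 with h3 | h3 <;>
          first
          | (simp only [Real.sign_of_pos, Real.sign_of_neg, h1, h2, h3]; norm_num; done)
          | (exfalso; nlinarith [mul_pos h1 p4, mul_pos h3 p2, mul_neg_of_neg_of_pos h2 p3])
          | (exfalso; nlinarith [mul_neg_of_neg_of_pos h1 p4, mul_neg_of_neg_of_pos h3 p2, mul_pos h2 p3])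
      unfold TT
      rw [h4]
      unfold ph
      ring
    have hdiff : ∀ a b c, TT D 1 (-1) (-1) (-1) 1 1 1 a b c -
        TT D (-1) (-1) (-1) (-1) 1 1 1 a b c = EE D 0 1 := by
      intro a b c
      rw [G.EE01]
      unfold TT ph
      ring
    rw [← hdiff, hz]
    simp only [Set.mem_insert_iff, Set.mem_singleton_iff] at k1
    rcases k1 with k1 | k1 | k1 <;> rw [k1] <;> norm_num

lemma mul_neg_ratio (p q : ℝ) (h : p * q < 0) : 0 < p / (p - q) ∧ p / (p - q) < 1 ∧ p - q ≠ 0 := by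
  rcases mul_neg_iff.1 h with ⟨h1, h2⟩ | ⟨h1, h2⟩
  · refine ⟨div_pos h1 (by linarith), ?_, by linarith⟩
    rw [div_lt_one (by linarith)]; linarith
  · refine ⟨div_pos_of_neg_of_neg h1 (by linarith), ?_, by linarith⟩
    rw [div_lt_one_of_neg (by linarith)]; linarith

lemma cross_pt (a b c d : ℂ) (h1 : orr a b c * orr a b d < 0) (h2 : orr c d a * orr c d b < 0) :
    ∃ t r : ℝ, 0 < t ∧ t < 1 ∧ 0 < r ∧ r < 1 ∧ a + t * (b - a) = c + r * (d - c) := by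
  obtain ⟨r0, r1, rn⟩ := mul_neg_ratio _ _ h1
  obtain ⟨t0, t1, tn⟩ := mul_neg_ratio _ _ h2
  refine ⟨_, _, t0, t1, r0, r1, ?_⟩
  set t := orr c d a / (orr c d a - orr c d b)
  set r := orr a b c / (orr a b c - orr a b d)
  have ht : t * (orr c d a - orr c d b) = orr c d a := div_mul_cancel₀ _ tn
  have hr : r * (orr a b c - orr a b d) = orr a b c := div_mul_cancel₀ _ rn
  apply Complex.ext
  · apply mul_right_cancel₀ tn
    simp only [Complex.add_re, Complex.add_im, Complex.re_ofReal_mul, Complex.im_ofReal_mul,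
      Complex.sub_re, Complex.sub_im]
    unfold orr at *
    linear_combination (b.re - a.re) * ht + (d.re - c.re) * hr
  · apply mul_right_cancel₀ tn
    simp only [Complex.add_re, Complex.add_im, Complex.re_ofReal_mul, Complex.im_ofReal_mul,
      Complex.sub_re, Complex.sub_im]
    unfold orr at *
    linear_combination (b.im - a.im) * ht + (d.im - c.im) * hr

lemma cross_num (A B C : ℝ) (hA : A ≠ 0) (hB : B ≠ 0)
    (k1 : C + 1 / 2 * A + 1 / 2 * B = -1 ∨ C + 1 / 2 * A + 1 / 2 * B = 0 ∨
      C + 1 / 2 * A + 1 / 2 * B = 1)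
    (k2 : C + -1 / 2 * A + 1 / 2 * B = -1 ∨ C + -1 / 2 * A + 1 / 2 * B = 0 ∨
      C + -1 / 2 * A + 1 / 2 * B = 1)
    (k3 : C + 1 / 2 * A + -1 / 2 * B = -1 ∨ C + 1 / 2 * A + -1 / 2 * B = 0 ∨
      C + 1 / 2 * A + -1 / 2 * B = 1)
    (k4 : C + -1 / 2 * A + -1 / 2 * B = -1 ∨ C + -1 / 2 * A + -1 / 2 * B = 0 ∨
      C + -1 / 2 * A + -1 / 2 * B = 1) : A = 1 ∨ A = -1 := by
  have a1 : A = 1 ∨ A = -1 ∨ A = 2 ∨ A = -2 := by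
    clear k3 k4
    rcases k1 with k1 | k1 | k1 <;> rcases k2 with k2 | k2 | k2 <;>
    first
    | (exfalso; apply hA; linarith)
    | (left; linarith)
    | (right; left; linarith)
    | (right; right; left; linarith)
    | (right; right; right; linarith)
  rcases a1 with h | h | h | h
  · exact Or.inl h
  · exact Or.inr h
  · exfalso
    apply hB
    have e1 : C + 1 / 2 * B = 0 := by
      rcases k1 with k1 | k1 | k1 <;> rcases k2 with k2 | k2 | k2 <;> linarith
    have e2 : C + -1 / 2 * B = 0 := by
      rcases k3 with k1 | k1 | k1 <;> rcases k4 with k2 | k2 | k2 <;> linarith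
    linarith
  · exfalso
    apply hB
    have e1 : C + 1 / 2 * B = 0 := by
      rcases k1 with k1 | k1 | k1 <;> rcases k2 with k2 | k2 | k2 <;> linarith
    have e2 : C + -1 / 2 * B = 0 := by
      rcases k3 with k1 | k1 | k1 <;> rcases k4 with k2 | k2 | k2 <;> linarith
    linarith

set_option maxHeartbeats 1000000 in
lemma Pre.cross (G : Pre z D) (c1 : orr (z 0) (z 1) (z 2) * orr (z 0) (z 1) (z 3) < 0)
    (c2 : orr (z 2) (z 3) (z 0) * orr (z 2) (z 3) (z 1) < 0) (hA : EE D 0 1 ≠ 0)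
    (hB : EE D 2 3 ≠ 0) : EE D 0 1 = 1 ∨ EE D 0 1 = -1 := by
  obtain ⟨t, r, ht0, ht1, hr0, hr1, hx'⟩ := cross_pt _ _ _ _ c1 c2
  obtain ⟨x, hx⟩ : ∃ x, x = z 0 + t * (z 1 - z 0) := ⟨_, rfl⟩
  rw [← hx] at hx'
  have n2 : orr (z 0) (z 1) (z 2) ≠ 0 := G.nd _ _ _ (by decide) (by decide) (by decide)
  have n3 : orr (z 0) (z 1) (z 3) ≠ 0 := G.nd _ _ _ (by decide) (by decide) (by decide)
  have n4 : orr (z 0) (z 1) (z 4) ≠ 0 := G.nd _ _ _ (by decide) (by decide) (by decide)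
  have n5 : orr (z 2) (z 3) (z 4) ≠ 0 := G.nd _ _ _ (by decide) (by decide) (by decide)
  have e0 : ∀ k, Real.sign (orr (z 0) (z k) x) = - Real.sign (orr (z 0) (z 1) (z k)) :=
    fun k => by rw [hx]; exact seg1 _ _ _ t ht0
  have e1 : ∀ k, Real.sign (orr (z 1) (z k) x) = Real.sign (orr (z 0) (z 1) (z k)) :=
    fun k => by rw [hx]; exact seg2 _ _ _ t ht1
  have e2 : ∀ k, Real.sign (orr (z 2) (z k) x) = - Real.sign (orr (z 2) (z 3) (z k)) :=
    fun k => by rw [hx']; exact seg1 _ _ _ r hr0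
  have e3 : ∀ k, Real.sign (orr (z 3) (z k) x) = Real.sign (orr (z 2) (z 3) (z k)) :=
    fun k => by rw [hx']; exact seg2 _ _ _ r hr1
  have nz : ∀ y : ℝ, U (Real.sign y) → y ≠ 0 := by
    intro y hy h; rw [h, Real.sign_zero] at hy; exact hy.ne rfl
  have Un : ∀ y : ℝ, U y → U (-y) := by
    rintro y (h | h) <;> rw [h]
    · right; rfl
    · left; norm_num
  have m0 : ∀ k, orr (z 0) (z 1) (z k) ≠ 0 → orr (z 0) (z k) x ≠ 0 := by
    intro k hk; apply nz; rw [e0]; exact Un _ (U_sign hk)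
  have m1 : ∀ k, orr (z 0) (z 1) (z k) ≠ 0 → orr (z 1) (z k) x ≠ 0 := by
    intro k hk; apply nz; rw [e1]; exact U_sign hk
  have n24 : orr (z 2) (z 4) x ≠ 0 := by
    apply nz; rw [e2]; exact Un _ (U_sign n5)
  have n34 : orr (z 3) (z 4) x ≠ 0 := by
    apply nz; rw [e3]; exact U_sign n5
  have hs3 : Real.sign (orr (z 0) (z 1) (z 3)) = - Real.sign (orr (z 0) (z 1) (z 2)) := by
    rcases mul_neg_iff.1 c1 with ⟨h1, h2⟩ | ⟨h1, h2⟩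
    · rw [Real.sign_of_pos h1, Real.sign_of_neg h2]
    · rw [Real.sign_of_pos h2, Real.sign_of_neg h1, neg_neg]
  have hpos : ∀ᶠ e : ℝ in nhdsWithin 0 (Set.Ioi 0), 0 < e := self_mem_nhdsWithin
  set K : ℝ := ((z 1).re - (z 0).re) * ((z 3).im - (z 2).im) -
    ((z 1).im - (z 0).im) * ((z 3).re - (z 2).re) with hK
  have hK0 : K ≠ 0 := by
    obtain ⟨-, -, h⟩ := mul_neg_ratio _ _ c1
    intro hk; apply h; rw [hK] at hk; unfold orr; linarith
  have hKK : 0 < K ^ 2 := by positivity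
  have key : ∀ p q : ℝ, U p → U q → TT D p (-Real.sign (orr (z 0) (z 1) (z 2)))
      (Real.sign (orr (z 0) (z 1) (z 2))) (-Real.sign (orr (z 0) (z 1) (z 4)))
      (Real.sign (orr (z 0) (z 1) (z 2))) (-Real.sign (orr (z 0) (z 1) (z 2)))
      (Real.sign (orr (z 0) (z 1) (z 4))) q
      (-Real.sign (orr (z 2) (z 3) (z 4))) (Real.sign (orr (z 2) (z 3) (z 4))) ∈
        ({-1, 0, 1} : Set ℝ) := by
    intro p q hp hq
    obtain ⟨d, hd⟩ : ∃ d : ℂ, d = (p * K : ℝ) * (z 3 - z 2) - (q * K : ℝ) * (z 1 - z 0) := ⟨_, rfl⟩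
    obtain ⟨e, he, h02, h03, h04, h12, h13, h14, h24, h34⟩ :=
      (hpos.and ((ev_sign _ _ _ d (m0 2 n2)).and ((ev_sign _ _ _ d (m0 3 n3)).and
      ((ev_sign _ _ _ d (m0 4 n4)).and ((ev_sign _ _ _ d (m1 2 n2)).and
      ((ev_sign _ _ _ d (m1 3 n3)).and ((ev_sign _ _ _ d (m1 4 n4)).and
      ((ev_sign _ _ _ d n24).and ((ev_sign _ _ _ d n34)))))))))).exists
    rw [e0] at h02 h03 h04
    rw [e1] at h12 h13 h14
    rw [hs3] at h03 h13
    rw [neg_neg] at h03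
    rw [e2] at h24
    rw [e3] at h34
    have sg : ∀ p : ℝ, U p → Real.sign ((e * K ^ 2) * p) = p := by
      intro p hp
      rw [sign_mul_pos' _ (mul_pos he hKK)]
      rcases hp with h | h <;> rw [h]
      · exact Real.sign_one
      · rw [Real.sign_neg, Real.sign_one]
    have h01 : Real.sign (orr (z 0) (z 1) (x + e * d)) = p := by
      have : orr (z 0) (z 1) (x + e * d) = (e * K ^ 2) * p := by
        rw [hx, hd, hK]; simp [orr]; ring
      rw [this, sg p hp]
    have h23 : Real.sign (orr (z 2) (z 3) (x + e * d)) = q := by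
      have : orr (z 2) (z 3) (x + e * d) = (e * K ^ 2) * q := by
        rw [hx', hd, hK]; simp [orr]; ring
      rw [this, sg q hq]
    have := G.val10 (x + e * d) h01 h02 h03 h04 h12 h13 h14 h23 h24 h34
      hp.ne (neg_ne_zero.2 (U_sign n2).ne) (U_sign n2).ne
      (neg_ne_zero.2 (U_sign n4).ne) (U_sign n2).ne (neg_ne_zero.2 (U_sign n2).ne) (U_sign n4).ne
      hq.ne (neg_ne_zero.2 (U_sign n5).ne) (U_sign n5).ne
    simpa using this
  have k1 := key 1 1 (Or.inl rfl) (Or.inl rfl)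
  have k2 := key (-1) 1 (Or.inr rfl) (Or.inl rfl)
  have k3 := key 1 (-1) (Or.inl rfl) (Or.inr rfl)
  have k4 := key (-1) (-1) (Or.inr rfl) (Or.inr rfl)
  have u2 := (U_sign n2).sq
  have u4 := (U_sign n4).sq
  have u5 := (U_sign n5).sq
  clear key hs3 e0 e1 e2 e3 m0 m1
  set σ2 := Real.sign (orr (z 0) (z 1) (z 2))
  set σ4 := Real.sign (orr (z 0) (z 1) (z 4))
  set ρ := Real.sign (orr (z 2) (z 3) (z 4))
  have hsum : ∀ p q, TT D p (-σ2) σ2 (-σ4) σ2 (-σ2) σ4 q (-ρ) ρ =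
      TT D 0 (-σ2) σ2 (-σ4) σ2 (-σ2) σ4 0 (-ρ) ρ + p / 2 * EE D 0 1 + q / 2 * EE D 2 3 := by
    intro p q
    rw [G.EE01, G.EE23]
    unfold TT ph
    linear_combination p * D 0 1 2 / 4 * u2 + p * D 0 1 3 / 4 * u2 + p * D 0 1 4 / 4 * u4 +
      q * D 0 2 3 / 4 * u2 + q * D 1 2 3 / 4 * u2 + q * D 2 3 4 / 4 * u5
  simp only [Set.mem_insert_iff, Set.mem_singleton_iff] at k1 k2 k3 k4
  rw [hsum] at k1 k2 k3 k4
  generalize TT D 0 (-σ2) σ2 (-σ4) σ2 (-σ2) σ4 0 (-ρ) ρ = C at k1 k2 k3 k4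
  generalize EE D 0 1 = A at *
  generalize EE D 2 3 = B at *
  exact cross_num A B C hA hB k1 k2 k3 k4

end

section
variable {z : Fin 5 → ℂ} {D : Fin 5 → Fin 5 → Fin 5 → ℝ}

lemma exists_perm4 : ∀ a b c d : Fin 5, [a, b, c, d].Nodup → ∃ p : Equiv.Perm (Fin 5),
    p 0 = a ∧ p 1 = b ∧ p 2 = c ∧ p 3 = d := by
  intro a b c d h
  refine ⟨Equiv.swap 0 a * Equiv.swap 1 (Equiv.swap 0 a b) *
    Equiv.swap 2 (Equiv.swap 1 (Equiv.swap 0 a b) (Equiv.swap 0 a c)) *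
    Equiv.swap 3 (Equiv.swap 2 (Equiv.swap 1 (Equiv.swap 0 a b) (Equiv.swap 0 a c))
      (Equiv.swap 1 (Equiv.swap 0 a b) (Equiv.swap 0 a d))), ?_⟩
  revert a b c d
  decide +kernel

lemma EE_perm (D : Fin 5 → Fin 5 → Fin 5 → ℝ) (p : Equiv.Perm (Fin 5)) (i j : Fin 5) :
    EE (fun i j k => D (p i) (p j) (p k)) i j = EE D (p i) (p j) := by
  unfold EE
  exact Equiv.sum_comp p (fun k => D (p i) (p j) k)

lemma Pre.EE_zero (G : Pre z D) (a b : Fin 5) : EE D a b = 0 := by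
  by_contra hab
  have hne : ∀ i j, i ≠ j → EE D i j ≠ 0 := fun i j hij h => hab (G.zero i j hij h a b)
  have hv : ∀ i j, i ≠ j → EE D i j = 1 ∨ EE D i j = -1 ∨ EE D i j = 2 ∨ EE D i j = -2 := by
    intro i j hij
    have h0 := hne i j hij
    obtain ⟨k, h1, h2⟩ : ∃ k, i ≠ k ∧ j ≠ k := by
      clear G h0 hne hab; revert i j; decide
    obtain ⟨p, rfl, rfl, -⟩ := exists_perm3 i j k hij h1 h2
    have := (G.perm p).edge.1
    rw [EE_perm] at this
    exact this.resolve_left h0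
  have hint : ∀ i j, ∃ n : ℤ, (n : ℝ) = EE D i j := by
    intro i j
    by_cases hij : i = j
    · subst hij
      exact ⟨0, by have := G.EE_anti i i; push_cast; linarith⟩
    · rcases hv i j hij with h | h | h | h <;> rw [h]
      exacts [⟨1, by norm_num⟩, ⟨-1, by norm_num⟩, ⟨2, by norm_num⟩, ⟨-2, by norm_num⟩]
  choose E hE using hint
  have c1 : ∀ i j, EE D i j = 1 ∨ EE D i j = -1 → E i j = 1 ∨ E i j = -1 := by
    intro i j h
    rw [← hE] at h
    exact_mod_cast h
  have GG : Good z E := by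
    refine ⟨G.nd, ?_, ?_, ?_, ?_, ?_, ?_⟩
    · intro i j
      have := G.EE_anti i j
      rw [← hE, ← hE] at this
      exact_mod_cast this
    · intro i j hij
      have := hv i j hij
      rw [← hE] at this
      exact_mod_cast this
    · intro i
      have := G.EE_sum i
      simp_rw [← hE] at this
      exact_mod_cast this
    · intro i
      have := G.tsum i
      simp_rw [← hE] at this
      exact_mod_cast this
    · intro i j hij hh
      apply c1
      have h0 := hne i j hij
      obtain ⟨k, h1, h2⟩ : ∃ k, i ≠ k ∧ j ≠ k := by
        clear * -; revert i j; decide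
      obtain ⟨p, rfl, rfl, -⟩ := exists_perm3 i j k hij h1 h2
      have := (G.perm p).edge.2 (hh _ (p.injective.ne (by decide)) (p.injective.ne (by decide)))
        (hh _ (p.injective.ne (by decide)) (p.injective.ne (by decide)))
        (hh _ (p.injective.ne (by decide)) (p.injective.ne (by decide)))
      rw [EE_perm] at this
      exact this.resolve_left h0
    · intro i j k l hd h1 h2
      apply c1
      obtain ⟨p, rfl, rfl, rfl, rfl⟩ := exists_perm4 i j k l hd
      have := (G.perm p).cross h1 h2
      rw [EE_perm, EE_perm] at this
      exact this (hne _ _ (p.injective.ne (by decide))) (hne _ _ (p.injective.ne (by decide)))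
  exact GG.false

lemma four_pt (a b c d w : ℂ) (h1 : orr a b w ≠ 0) (h2 : orr a c w ≠ 0) (h3 : orr a d w ≠ 0)
    (h4 : orr b c w ≠ 0) (h5 : orr b d w ≠ 0) (h6 : orr c d w ≠ 0) :
    ph (Real.sign (orr b c w)) (Real.sign (orr c d w)) (-Real.sign (orr b d w)) -
    ph (Real.sign (orr a b w)) (Real.sign (orr b c w)) (-Real.sign (orr a c w)) -
    ph (Real.sign (orr a c w)) (Real.sign (orr c d w)) (-Real.sign (orr a d w)) +
    ph (Real.sign (orr a b w)) (Real.sign (orr b d w)) (-Real.sign (orr a d w)) = 0 := by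
  have gp : orr a b w * orr c d w - orr a c w * orr b d w + orr a d w * orr b c w = 0 := by
    unfold orr; ring
  generalize orr a b w = x1 at *
  generalize orr a c w = x2 at *
  generalize orr a d w = x3 at *
  generalize orr b c w = x4 at *
  generalize orr b d w = x5 at *
  generalize orr c d w = x6 at *
  have key : ∀ x y : ℝ, x ≠ 0 → y ≠ 0 → (0 < x * y ∧ Real.sign x * Real.sign y = 1) ∨
      (x * y < 0 ∧ Real.sign x * Real.sign y = -1) := by
    intro x y hx hy
    rcases lt_or_gt_of_ne hx with h | h <;> rcases lt_or_gt_of_ne hy with h' | h'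
    · left; rw [Real.sign_of_neg h, Real.sign_of_neg h']
      exact ⟨mul_pos_of_neg_of_neg h h', by norm_num⟩
    · right; rw [Real.sign_of_neg h, Real.sign_of_pos h']
      exact ⟨mul_neg_of_neg_of_pos h h', by norm_num⟩
    · right; rw [Real.sign_of_pos h, Real.sign_of_neg h']
      exact ⟨mul_neg_of_pos_of_neg h h', by norm_num⟩
    · left; rw [Real.sign_of_pos h, Real.sign_of_pos h']
      exact ⟨mul_pos h h', by norm_num⟩
  have k1 := key _ _ h1 h6
  have k2 := key _ _ h2 h5
  have k3 := key _ _ h3 h4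
  have u4 := (U_sign h4).sq
  have u5 := (U_sign h5).sq
  have u6 := (U_sign h6).sq
  generalize Real.sign x1 = s1 at *
  generalize Real.sign x2 = s2 at *
  generalize Real.sign x3 = s3 at *
  generalize Real.sign x4 = s4 at *
  generalize Real.sign x5 = s5 at *
  generalize Real.sign x6 = s6 at *
  have hP : 1 - (s1 * s6) * (s2 * s5) - (s2 * s5) * (s3 * s4) + (s1 * s6) * (s3 * s4) = 0 := by
    rcases k1 with ⟨p1, k1⟩ | ⟨p1, k1⟩ <;> rcases k2 with ⟨p2, k2⟩ | ⟨p2, k2⟩ <;>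
      rcases k3 with ⟨p3, k3⟩ | ⟨p3, k3⟩ <;> rw [k1, k2, k3] <;>
      first
      | (norm_num; done)
      | (exfalso; linarith)
  unfold ph
  linear_combination (-(s4 * s5 * s6) / 4) * hP - s1 * s2 * s4 / 4 * (s6 ^ 2 * u5 + u6) -
    s2 * s3 * s6 / 4 * (s5 ^ 2 * u4 + u5) + s1 * s3 * s5 / 4 * (s6 ^ 2 * u4 + u6)

lemma Pre.FF_zero (G : Pre z D) (w : ℂ) (hw : ∀ i j, i ≠ j → orr (z i) (z j) w ≠ 0) :
    FF D (ss z w) = 0 := by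
  have h12 := G.EE_zero 1 2
  have h13 := G.EE_zero 1 3
  have h14 := G.EE_zero 1 4
  have h23 := G.EE_zero 2 3
  have h24 := G.EE_zero 2 4
  have h34 := G.EE_zero 3 4
  unfold EE at h12 h13 h14 h23 h24 h34
  have a1 := G.a1
  have a2 := G.a2
  have r : ∀ i j k, D j k i = D i j k := fun i j k => by rw [a2 j i k, a1 i j k, neg_neg]
  have q1 := fun i k => (G.D0 i k).1
  have q2 := fun i k => (G.D0 i k).2.1
  have q3 := fun i k => (G.D0 i k).2.2
  rw [Fin.sum_univ_five] at h12 h13 h14 h23 h24 h34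
  simp only [q1, q2, q3] at h12 h13 h14 h23 h24 h34
  rw [r 0 1 2] at h12
  rw [r 0 1 3, a2 1 2 3] at h13
  rw [r 0 1 4, a2 1 2 4, a2 1 3 4] at h14
  rw [r 0 2 3, r 1 2 3] at h23
  rw [r 0 2 4, r 1 2 4, a2 2 3 4] at h24
  rw [r 0 3 4, r 1 3 4, r 2 3 4] at h34
  have f : ∀ a b c d : Fin 5, [a, b, c, d].Nodup → ph (ss z w b c) (ss z w c d) (-ss z w b d) -
    ph (ss z w a b) (ss z w b c) (-ss z w a c) -
    ph (ss z w a c) (ss z w c d) (-ss z w a d) +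
    ph (ss z w a b) (ss z w b d) (-ss z w a d) = 0 := by
    intro a b c d hd
    simp only [List.nodup_cons, List.mem_cons, List.not_mem_nil, or_false, not_or] at hd
    obtain ⟨⟨d1, d2, d3⟩, ⟨d4, d5⟩, d6, -⟩ := hd
    exact four_pt _ _ _ _ w (hw _ _ d1) (hw _ _ d2) (hw _ _ d3) (hw _ _ d4) (hw _ _ d5) (hw _ _ d6)
  have f1 := f 0 1 2 3 (by decide)
  have f2 := f 0 1 2 4 (by decide)
  have f3 := f 0 1 3 4 (by decide)
  have f4 := f 0 2 3 4 (by decide)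
  rw [Pre.ten G.a1 G.a2 _ (ss_anti z w)]
  clear f hw r a1 a2 q1 q2 q3 G
  generalize ss z w = s at *
  linear_combination 6 * (D 1 2 3 * f1 + D 1 2 4 * f2 + D 1 3 4 * f3 + D 2 3 4 * f4 +
    h12 * ph (s 0 1) (s 1 2) (-s 0 2) + h13 * ph (s 0 1) (s 1 3) (-s 0 3) +
    h14 * ph (s 0 1) (s 1 4) (-s 0 4) + h23 * ph (s 0 2) (s 2 3) (-s 0 3) +
    h24 * ph (s 0 2) (s 2 4) (-s 0 4) + h34 * ph (s 0 3) (s 3 4) (-s 0 4))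

end

lemma sum_ten {K : Type*} [AddCommMonoid K] (A : Fin 5 → Fin 5 → Fin 5 → K) :
    ∑ p ∈ Finset.univ.filter (fun p : Fin 5 × Fin 5 × Fin 5 => p.1 < p.2.1 ∧ p.2.1 < p.2.2),
      A p.1 p.2.1 p.2.2 = A 0 1 2 + A 0 1 3 + A 0 1 4 + A 0 2 3 + A 0 2 4 + A 0 3 4 +
      A 1 2 3 + A 1 2 4 + A 1 3 4 + A 2 3 4 := by
  rw [show (Finset.univ.filter (fun p : Fin 5 × Fin 5 × Fin 5 => p.1 < p.2.1 ∧ p.2.1 < p.2.2)) =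
    {(0, 1, 2), (0, 1, 3), (0, 1, 4), (0, 2, 3), (0, 2, 4), (0, 3, 4), (1, 2, 3), (1, 2, 4),
      (1, 3, 4), (2, 3, 4)} by decide +kernel]
  repeat rw [Finset.sum_insert (by decide)]
  rw [Finset.sum_singleton]
  simp only [add_assoc]

lemma orr_ne_zero_of (a b c : ℂ) (hab : a ≠ b) (h : ¬ Collinear ℝ ({a, b, c} : Set ℂ)) :
    orr a b c ≠ 0 := by
  intro h0
  apply h
  have hba : b - a ≠ 0 := sub_ne_zero.2 hab.symm
  rw [collinear_iff_of_mem (p₀ := a) (by simp)]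
  refine ⟨b - a, ?_⟩
  intro p hp
  simp only [Set.mem_insert_iff, Set.mem_singleton_iff] at hp
  rcases hp with rfl | rfl | rfl
  · exact ⟨0, by simp⟩
  · exact ⟨1, by simp⟩
  · refine ⟨((p - a) / (b - a)).re, ?_⟩
    have him : ((p - a) / (b - a)).im = 0 := by
      rw [Complex.div_im]
      simp only [Complex.sub_re, Complex.sub_im]
      unfold orr at h0
      rw [← sub_div, div_eq_zero_iff]
      left; linarith
    have hr : ((((p - a) / (b - a)).re : ℝ) : ℂ) = (p - a) / (b - a) := by
      apply Complex.ext
      · simp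
      · simp [him]
    rw [Complex.real_smul, hr, div_mul_cancel₀ _ hba]
    simp

lemma ae_orr (a b : ℂ) (hab : a ≠ b) : ∀ᵐ w : ℂ, orr a b w ≠ 0 := by
  let l : ℂ →ₗ[ℝ] ℝ := (b.re - a.re) • Complex.imLm - (b.im - a.im) • Complex.reLm
  let S : AffineSubspace ℝ ℂ := AffineSubspace.mk' a (LinearMap.ker l)
  have hmem : ∀ w, w ∈ S ↔ orr a b w = 0 := by
    intro w
    simp only [S, l, AffineSubspace.mem_mk', LinearMap.mem_ker]
    simp [orr]
  have hS : S ≠ ⊤ := by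
    intro h
    have : a + Complex.I * (b - a) ∈ S := by rw [h]; trivial
    rw [hmem] at this
    have hN : 0 < Complex.normSq (b - a) := Complex.normSq_pos.2 (sub_ne_zero.2 hab.symm)
    rw [Complex.normSq_apply] at hN
    simp [orr] at this hN
    linarith
  have := Measure.addHaar_affineSubspace (volume : Measure ℂ) S hS
  rw [ae_iff]
  convert this using 2
  ext w
  simp [hmem]

lemma mem_tri_iff (a b c w : ℂ) (h : orr a b c ≠ 0) : w ∈ convexHull ℝ ({a, b, c} : Set ℂ) ↔
    0 ≤ orr a b w / orr a b c ∧ 0 ≤ orr b c w / orr a b c ∧ 0 ≤ -orr a c w / orr a b c := by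
  rw [mem_tri]
  have hsum : orr a b w + orr b c w - orr a c w = orr a b c := by unfold orr; ring
  constructor
  · rintro ⟨s, t, hs, ht, hst, rfl⟩
    have e1 : orr a b (a + s * (b - a) + t * (c - a)) = t * orr a b c := by simp [orr]; ring
    have e2 : orr b c (a + s * (b - a) + t * (c - a)) = (1 - s - t) * orr a b c := by
      simp [orr]; ring
    have e3 : -orr a c (a + s * (b - a) + t * (c - a)) = s * orr a b c := by simp [orr]; ring
    rw [e1, e2, e3, mul_div_cancel_right₀ _ h, mul_div_cancel_right₀ _ h, mul_div_cancel_right₀ _ h]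
    exact ⟨ht, by linarith, hs⟩
  · rintro ⟨h1, h2, h3⟩
    refine ⟨_, _, h3, h1, ?_, ?_⟩
    · have : orr a b w / orr a b c + orr b c w / orr a b c + -orr a c w / orr a b c = 1 := by
        rw [← add_div, ← add_div, ← sub_eq_add_neg, hsum, div_self h]
      linarith
    · have hC : (orr a b c : ℂ) ≠ 0 := by exact_mod_cast h
      push_cast
      field_simp
      apply Complex.ext <;> simp [orr] <;> ring

lemma chi_eq (a b c w : ℂ) (h : orr a b c ≠ 0) (h1 : orr a b w ≠ 0) (h2 : orr b c w ≠ 0)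
    (h3 : orr a c w ≠ 0) : (convexHull ℝ ({a, b, c} : Set ℂ)).indicator (fun _ => (1 : ℝ)) w =
      Real.sign (orr a b c) * ph (Real.sign (orr a b w)) (Real.sign (orr b c w))
        (-Real.sign (orr a c w)) := by
  classical
  have hsum : orr a b w + orr b c w - orr a c w = orr a b c := by unfold orr; ring
  rw [Set.indicator_apply]
  simp only [mem_tri_iff a b c w h]
  generalize orr a b c = o at *
  generalize orr a b w = p at *
  generalize orr b c w = q at *
  generalize orr a c w = r at *
  unfold ph
  rcases lt_or_gt_of_ne h with ho | ho
  · simp only [div_nonneg_iff, not_le.2 ho, and_false, false_or, ho.le, and_true]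
    rcases lt_or_gt_of_ne h1 with k1 | k1 <;> rcases lt_or_gt_of_ne h2 with k2 | k2 <;>
    rcases lt_or_gt_of_ne h3 with k3 | k3 <;>
    first
    | (exfalso; linarith)
    | (simp [Real.sign_of_pos, Real.sign_of_neg, k1, k2, k3, ho, k1.le, k2.le, k3.le, not_le.2 k1,
        not_le.2 k2, not_le.2 k3]; done)
    | (simp [Real.sign_of_pos, Real.sign_of_neg, k1, k2, k3, ho, k1.le, k2.le, k3.le, not_le.2 k1,
        not_le.2 k2, not_le.2 k3]; norm_num)
  · simp only [div_nonneg_iff, not_le.2 ho, and_false, or_false, ho.le, and_true]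
    rcases lt_or_gt_of_ne h1 with k1 | k1 <;> rcases lt_or_gt_of_ne h2 with k2 | k2 <;>
    rcases lt_or_gt_of_ne h3 with k3 | k3 <;>
    first
    | (exfalso; linarith)
    | (simp [Real.sign_of_pos, Real.sign_of_neg, k1, k2, k3, ho, k1.le, k2.le, k3.le, not_le.2 k1,
        not_le.2 k2, not_le.2 k3]; done)
    | (simp [Real.sign_of_pos, Real.sign_of_neg, k1, k2, k3, ho, k1.le, k2.le, k3.le, not_le.2 k1,
        not_le.2 k2, not_le.2 k3]; norm_num)

lemma ev_sign_nhds (a b x : ℂ) (h : orr a b x ≠ 0) :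
    ∀ᶠ w : ℂ in nhds x, Real.sign (orr a b w) = Real.sign (orr a b x) := by
  have hc : Continuous fun w : ℂ => orr a b w := by
    unfold orr; fun_prop
  have ht := hc.tendsto x
  rcases lt_or_gt_of_ne h with h' | h'
  · filter_upwards [ht.eventually_lt_const h'] with e he
    rw [Real.sign_of_neg he, Real.sign_of_neg h']
  · filter_upwards [ht.eventually_const_lt h'] with e he
    rw [Real.sign_of_pos he, Real.sign_of_pos h']

noncomputable def Gc (c : Fin 5 → Fin 5 → Fin 5 → ℝ) (i j k : Fin 5) : ℝ :=
  if i < j ∧ j < k then c i j k else 0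

noncomputable def Cs (c : Fin 5 → Fin 5 → Fin 5 → ℝ) (i j k : Fin 5) : ℝ :=
  Gc c i j k + Gc c i k j + Gc c j i k + Gc c j k i + Gc c k i j + Gc c k j i

noncomputable def Dc (z : Fin 5 → ℂ) (c : Fin 5 → Fin 5 → Fin 5 → ℝ) (i j k : Fin 5) : ℝ :=
  Cs c i j k * Real.sign (orr (z i) (z j) (z k))

lemma Cs_sorted (c : Fin 5 → Fin 5 → Fin 5 → ℝ) (i j k : Fin 5) (h1 : i < j) (h2 : j < k) :
    Cs c i j k = c i j k := by
  have h3 := h1.trans h2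
  simp [Cs, Gc, h1, h2, h3, h1.not_gt, h2.not_gt, h3.not_gt]

lemma Dc_a1 (z : Fin 5 → ℂ) (c : Fin 5 → Fin 5 → Fin 5 → ℝ) (i j k : Fin 5) :
    Dc z c j i k = - Dc z c i j k := by
  unfold Dc
  rw [show orr (z j) (z i) (z k) = -orr (z i) (z j) (z k) by unfold orr; ring, Real.sign_neg]
  unfold Cs; ring

lemma Dc_a2 (z : Fin 5 → ℂ) (c : Fin 5 → Fin 5 → Fin 5 → ℝ) (i j k : Fin 5) :
    Dc z c i k j = - Dc z c i j k := by
  unfold Dc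
  rw [show orr (z i) (z k) (z j) = -orr (z i) (z j) (z k) by unfold orr; ring, Real.sign_neg]
  unfold Cs; ring

lemma sum_rot {K : Type*} [AddCommMonoid K] (A : Fin 5 → Fin 5 → Fin 5 → K) :
    ∑ i, ∑ j, ∑ k, A j k i = ∑ i, ∑ j, ∑ k, A i j k := by
  rw [Finset.sum_comm]
  refine Finset.sum_congr rfl fun i _ => ?_
  rw [Finset.sum_comm]

lemma dd_sw1 (G : Polynomial ℂ) (a b c : ℂ) : dd G b a c = dd G a b c := by
  unfold dd
  rw [mul_comm (c - b)]
  ring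

lemma dd_sw2 (G : Polynomial ℂ) (a b c : ℂ) : dd G a c b = dd G a b c := by
  unfold dd
  rw [mul_comm (a - c), mul_comm (c - a), mul_comm (b - a)]
  ring

section
variable {z : Fin 5 → ℂ} {c : Fin 5 → Fin 5 → Fin 5 → ℝ} {f : ℂ → ℝ}

lemma f_eq (hnd : ∀ i j k, i ≠ j → i ≠ k → j ≠ k → orr (z i) (z j) (z k) ≠ 0)
    (hf : f = fun w =>
      ∑ p ∈ Finset.univ.filter
          (fun p : Fin 5 × Fin 5 × Fin 5 => p.1 < p.2.1 ∧ p.2.1 < p.2.2),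
        c p.1 p.2.1 p.2.2 *
          (convexHull ℝ ({z p.1, z p.2.1, z p.2.2} : Set ℂ)).indicator (fun _ => (1 : ℝ)) w)
    (w : ℂ) (hw : ∀ i j, i ≠ j → orr (z i) (z j) w ≠ 0) : 6 * f w = FF (Dc z c) (ss z w) := by
  rw [Pre.ten (Dc_a1 z c) (Dc_a2 z c) _ (ss_anti z w), hf]
  dsimp only
  rw [sum_ten (fun i j k => c i j k *
    (convexHull ℝ ({z i, z j, z k} : Set ℂ)).indicator (fun _ => (1 : ℝ)) w)]
  have e : ∀ i j k : Fin 5, i < j → j < k → c i j k *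
      (convexHull ℝ ({z i, z j, z k} : Set ℂ)).indicator (fun _ => (1 : ℝ)) w =
      Dc z c i j k * ph (ss z w i j) (ss z w j k) (-ss z w i k) := by
    intro i j k h1 h2
    rw [chi_eq _ _ _ w (hnd i j k h1.ne (h1.trans h2).ne h2.ne) (hw i j h1.ne) (hw j k h2.ne)
      (hw i k (h1.trans h2).ne)]
    unfold Dc ss
    rw [Cs_sorted c i j k h1 h2, mul_assoc]
  rw [e 0 1 2 (by decide) (by decide), e 0 1 3 (by decide) (by decide),
    e 0 1 4 (by decide) (by decide), e 0 2 3 (by decide) (by decide),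
    e 0 2 4 (by decide) (by decide), e 0 3 4 (by decide) (by decide),
    e 1 2 3 (by decide) (by decide), e 1 2 4 (by decide) (by decide),
    e 1 3 4 (by decide) (by decide), e 2 3 4 (by decide) (by decide)]

lemma f_mul (hf : f = fun w =>
      ∑ p ∈ Finset.univ.filter
          (fun p : Fin 5 × Fin 5 × Fin 5 => p.1 < p.2.1 ∧ p.2.1 < p.2.2),
        c p.1 p.2.1 p.2.2 *
          (convexHull ℝ ({z p.1, z p.2.1, z p.2.2} : Set ℂ)).indicator (fun _ => (1 : ℝ)) w)
    (g : ℂ → ℂ) (hg : Continuous g) : Integrable (fun w => (f w : ℂ) * g w) ∧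
    ∫ w, (f w : ℂ) * g w = ∑ p ∈ Finset.univ.filter
      (fun p : Fin 5 × Fin 5 × Fin 5 => p.1 < p.2.1 ∧ p.2.1 < p.2.2),
      (c p.1 p.2.1 p.2.2 : ℂ) * ∫ w in convexHull ℝ ({z p.1, z p.2.1, z p.2.2} : Set ℂ), g w := by
  have e : (fun w => (f w : ℂ) * g w) = fun w => ∑ p ∈ Finset.univ.filter
      (fun p : Fin 5 × Fin 5 × Fin 5 => p.1 < p.2.1 ∧ p.2.1 < p.2.2), (c p.1 p.2.1 p.2.2 : ℂ) *
      (convexHull ℝ ({z p.1, z p.2.1, z p.2.2} : Set ℂ)).indicator g w := by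
    classical
    funext w
    rw [hf]
    dsimp only
    rw [Complex.ofReal_sum, Finset.sum_mul]
    refine Finset.sum_congr rfl fun p _ => ?_
    rw [Set.indicator_apply, Set.indicator_apply]
    split_ifs <;> simp
  have hi : ∀ p : Fin 5 × Fin 5 × Fin 5, Integrable (fun w => (c p.1 p.2.1 p.2.2 : ℂ) *
      (convexHull ℝ ({z p.1, z p.2.1, z p.2.2} : Set ℂ)).indicator g w) := by
    intro p
    apply Integrable.const_mul
    rw [integrable_indicator_iff (isCompact_tri _ _ _).measurableSet]
    exact hg.continuousOn.integrableOn_compact (isCompact_tri _ _ _)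
  rw [e]
  refine ⟨integrable_finset_sum _ fun p _ => hi p, ?_⟩
  rw [integral_finset_sum _ fun p _ => hi p]
  refine Finset.sum_congr rfl fun p _ => ?_
  rw [integral_const_mul, integral_indicator (isCompact_tri _ _ _).measurableSet]

lemma f_poly (hf : f = fun w =>
      ∑ p ∈ Finset.univ.filter
          (fun p : Fin 5 × Fin 5 × Fin 5 => p.1 < p.2.1 ∧ p.2.1 < p.2.2),
        c p.1 p.2.1 p.2.2 *
          (convexHull ℝ ({z p.1, z p.2.1, z p.2.2} : Set ℂ)).indicator (fun _ => (1 : ℝ)) w)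
    (hmom : ∀ k : ℕ, ∫ w : ℂ, (f w : ℂ) * w ^ k = 0) (P : Polynomial ℂ) :
    ∫ w, (f w : ℂ) * P.eval w = 0 := by
  have e : (fun w => (f w : ℂ) * P.eval w) = fun w => ∑ i ∈ Finset.range (P.natDegree + 1),
      P.coeff i * ((f w : ℂ) * w ^ i) := by
    funext w
    rw [Polynomial.eval_eq_sum_range, Finset.mul_sum]
    exact Finset.sum_congr rfl fun i _ => by ring
  rw [e, integral_finset_sum]
  · refine Finset.sum_eq_zero fun i _ => ?_
    rw [integral_const_mul, hmom, mul_zero]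
  · intro i _
    exact ((f_mul hf (fun w => w ^ i) (by fun_prop)).1).const_mul _

lemma pre_of (hnd : ∀ i j k, i ≠ j → i ≠ k → j ≠ k → orr (z i) (z j) (z k) ≠ 0)
    (hf : f = fun w =>
      ∑ p ∈ Finset.univ.filter
          (fun p : Fin 5 × Fin 5 × Fin 5 => p.1 < p.2.1 ∧ p.2.1 < p.2.2),
        c p.1 p.2.1 p.2.2 *
          (convexHull ℝ ({z p.1, z p.2.1, z p.2.2} : Set ℂ)).indicator (fun _ => (1 : ℝ)) w)
    (hval : ∀ᵐ w : ℂ, f w = -1 ∨ f w = 0 ∨ f w = 1)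
    (hmom : ∀ k : ℕ, ∫ w : ℂ, (f w : ℂ) * w ^ k = 0) : Pre z (Dc z c) := by
  refine ⟨hnd, Dc_a1 z c, Dc_a2 z c, ?_, ?_⟩
  · intro w0 hw0
    have hev : ∀ᶠ w in nhds w0, ∀ i j, ss z w i j = ss z w0 i j := by
      rw [Filter.eventually_all]; intro i
      rw [Filter.eventually_all]; intro j
      by_cases hij : i = j
      · subst hij
        refine Filter.Eventually.of_forall fun w => ?_
        have h1 := ss_anti z w i i
        have h2 := ss_anti z w0 i i
        linarith
      · exact ev_sign_nhds _ _ _ (hw0 i j hij)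
    obtain ⟨w, h1, h2⟩ := (Measure.dense_of_ae hval).inter_nhds_nonempty hev
    have hss : ss z w = ss z w0 := by funext i j; exact h2 i j
    have hw : ∀ i j, i ≠ j → orr (z i) (z j) w ≠ 0 := by
      intro i j hij h0
      have := h2 i j
      unfold ss at this
      rw [h0, Real.sign_zero] at this
      exact (U_sign (hw0 i j hij)).ne this.symm
    have := f_eq hnd hf w hw
    rw [hss] at this
    rw [← this]
    rcases h1 with h | h | h <;> rw [h] <;> norm_num
  · intro G
    set A : Fin 5 → Fin 5 → Fin 5 → ℂ := fun i j k => (Dc z c i j k : ℂ) *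
      orr (z i) (z j) (z k) * (G.eval (z i) / ((z i - z j) * (z i - z k))) with hA
    set B : Fin 5 → Fin 5 → Fin 5 → ℂ := fun i j k => (Dc z c i j k : ℂ) *
      orr (z i) (z j) (z k) * dd G (z i) (z j) (z k) with hB
    have hAB : ∀ i j k, B i j k = A i j k + A j k i + A k i j := by
      intro i j k
      have r1 : ∀ i j k, Dc z c j k i = Dc z c i j k := fun i j k => by
        rw [Dc_a2 z c j i k, Dc_a1 z c i j k, neg_neg]
      have r2 : ∀ a b c, orr b c a = orr a b c := by intros; unfold orr; ring
      simp only [hA, hB]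
      rw [r1 i j k, r1 k i j, r2 (z i) (z j) (z k), r2 (z k) (z i) (z j)]
      unfold dd
      rw [mul_comm (z j - z i)]
      ring
    have hsum : ∑ i, ∑ j, ∑ k, B i j k = 3 * ∑ i, ∑ j, ∑ k, A i j k := by
      simp only [hAB, Finset.sum_add_distrib]
      rw [sum_rot A, sum_rot (fun i j k => A j k i), sum_rot A]
      ring
    have hten := sym_sum B
      (by
        intro i j k
        simp only [hB]
        rw [Dc_a1 z c i j k, dd_sw1,
          show orr (z j) (z i) (z k) = -orr (z i) (z j) (z k) by unfold orr; ring]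
        push_cast; ring)
      (by
        intro i j k
        simp only [hB]
        rw [Dc_a2 z c i j k, dd_sw2,
          show orr (z i) (z k) (z j) = -orr (z i) (z j) (z k) by unfold orr; ring]
        push_cast; ring)
      (by
        intro i k
        simp only [hB]
        rw [show orr (z i) (z i) (z k) = 0 by unfold orr; ring]
        simp)
    have hm := f_poly hf hmom G.derivative.derivative
    rw [(f_mul hf _ (by fun_prop)).2, sum_ten (fun i j k => (c i j k : ℂ) *
      ∫ w in convexHull ℝ ({z i, z j, z k} : Set ℂ), G.derivative.derivative.eval w)] at hm
    have e : ∀ i j k : Fin 5, i < j → j < k → (c i j k : ℂ) *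
        ∫ w in convexHull ℝ ({z i, z j, z k} : Set ℂ), G.derivative.derivative.eval w =
        B i j k := by
      intro i j k h1 h2
      have ho := hnd i j k h1.ne (h1.trans h2).ne h2.ne
      rw [integral_tri_poly _ _ _ ho]
      simp only [hB]
      unfold Dc
      rw [Cs_sorted c i j k h1 h2, ← mul_assoc]
      congr 1
      have : |orr (z i) (z j) (z k)| =
          Real.sign (orr (z i) (z j) (z k)) * orr (z i) (z j) (z k) := by
        rcases lt_or_gt_of_ne ho with h | h
        · rw [Real.sign_of_neg h, abs_of_neg h]; ring
        · rw [Real.sign_of_pos h, abs_of_pos h]; ring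
      rw [this]
      push_cast; ring
    rw [e 0 1 2 (by decide) (by decide), e 0 1 3 (by decide) (by decide),
      e 0 1 4 (by decide) (by decide), e 0 2 3 (by decide) (by decide),
      e 0 2 4 (by decide) (by decide), e 0 3 4 (by decide) (by decide),
      e 1 2 3 (by decide) (by decide), e 1 2 4 (by decide) (by decide),
      e 1 3 4 (by decide) (by decide), e 2 3 4 (by decide) (by decide)] at hm
    rw [hm, mul_zero, hsum] at hten
    exact (mul_eq_zero.1 hten).resolve_left (by norm_num)

end

/-- For a nondegenerate 5-tuple `z_0, …, z_4 ∈ ℂ`, any real polygonal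
measure with nodes among the `z_i`, whose density takes only the values `0, ±1` almost
everywhere and whose harmonic moments all vanish, is almost everywhere zero. In other
words, no 5-point set admits a pair of equipotential polygons. -/
theorem no_equipotential_polygons_five_points
    (z : Fin 5 → ℂ) (hz : Nondegenerate z)
    (c : Fin 5 → Fin 5 → Fin 5 → ℝ)
    (f : ℂ → ℝ)
    (hf : f = fun w =>
      ∑ p ∈ Finset.univ.filter
          (fun p : Fin 5 × Fin 5 × Fin 5 => p.1 < p.2.1 ∧ p.2.1 < p.2.2),
        c p.1 p.2.1 p.2.2 *
          (convexHull ℝ ({z p.1, z p.2.1, z p.2.2} : Set ℂ)).indicator (fun _ => (1 : ℝ)) w)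
    (hval : ∀ᵐ w : ℂ, f w = -1 ∨ f w = 0 ∨ f w = 1)
    (hmom : ∀ k : ℕ, ∫ w : ℂ, (f w : ℂ) * w ^ k = 0) :
    ∀ᵐ w : ℂ, f w = 0 := by
  have hnd : ∀ i j k, i ≠ j → i ≠ k → j ≠ k → orr (z i) (z j) (z k) ≠ 0 := fun i j k h1 h2 h3 =>
    orr_ne_zero_of _ _ _ (hz.1.ne h1) (hz.2 i j k h1 h2 h3)
  have hP := pre_of hnd hf hval hmom
  have hae : ∀ᵐ w : ℂ, ∀ i j, i ≠ j → orr (z i) (z j) w ≠ 0 := by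
    rw [ae_all_iff]; intro i
    rw [ae_all_iff]; intro j
    by_cases hij : i = j
    · exact Filter.Eventually.of_forall fun w h => absurd hij h
    · filter_upwards [ae_orr _ _ (hz.1.ne hij)] with w hw _
      exact hw
  filter_upwards [hae] with w hw
  have h1 := f_eq hnd hf w hw
  rw [hP.FF_zero w hw] at h1
  linarith
end

section
/- Let n ≥ 2 and let z_0, z_1, …, z_n ∈ ℂ be nondegenerate. For every family a = (a_{ij})_{2≤i<j≤n} of complex numbers there exists a unique family c = (c_{ij})_{1≤i<j≤n} of complex numbers such that c_{ij} = a_{ij} for all 2 ≤ i < j ≤ n and, for every natural number k, Σ_{1≤i<j≤n} c_{ij} · ∫_{convexHull ℝ {z_0,z_i,z_j}} w^k dvolume(w) = 0. In other words, the space of complex polygonal measures with vertices among z_0,…,z_n and all harmonic moments vanishing projects isomorphically onto the coordinates indexed by the triangles not containing z_1. -/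
open MeasureTheory

/-- The index type of pairs `(i, j)` with `1 ≤ i < j ≤ n`; it has cardinality `C(n,2)`. -/
def PairIdx (n : ℕ) : Type :=
  {p : Fin (n + 1) × Fin (n + 1) // 0 < (p.1 : ℕ) ∧ (p.1 : ℕ) < (p.2 : ℕ)}

instance (n : ℕ) : Fintype (PairIdx n) := by
  unfold PairIdx; infer_instance

noncomputable def hq (k : ℕ) (A B C : ℂ) : ℂ :=
  ((B^(k+2)-C^(k+2))/(B-C) - (B^(k+2)-A^(k+2))/(B-A))/(C-A)

lemma hq_succ (k : ℕ) (A B C : ℂ) (h1 : B ≠ C) (h2 : B ≠ A) (h3 : C ≠ A) :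
    hq (k+1) A B C - A * hq k A B C = (B^(k+2)-C^(k+2))/(B-C) := by
  unfold hq
  have h1 := sub_ne_zero.2 h1
  have h2 := sub_ne_zero.2 h2
  have h3 := sub_ne_zero.2 h3
  field_simp
  ring

lemma hq_zero (A B C : ℂ) (h1 : B ≠ C) (h2 : B ≠ A) (h3 : C ≠ A) :
    hq 0 A B C = (B^(0+1)-C^(0+1))/(B-C) := by
  unfold hq
  have h1 := sub_ne_zero.2 h1
  have h2 := sub_ne_zero.2 h2
  have h3 := sub_ne_zero.2 h3
  field_simp
  ring

lemma hull_std : convexHull ℝ ({0, 1, Complex.I} : Set ℂ) =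
    {w : ℂ | 0 ≤ w.re ∧ 0 ≤ w.im ∧ w.re + w.im ≤ 1} := by
  apply Set.Subset.antisymm
  · apply convexHull_min
    · rintro x (rfl | rfl | rfl) <;> simp
    · rintro x ⟨h1, h2, h3⟩ y ⟨h4, h5, h6⟩ a b ha hb hab
      simp only [Set.mem_ofPred_eq, Complex.add_re, Complex.add_im, Complex.real_smul,
        Complex.re_ofReal_mul, Complex.im_ofReal_mul]
      refine ⟨by positivity, by positivity, ?_⟩
      nlinarith
  · rintro w ⟨h1, h2, h3⟩
    have hc := convex_convexHull ℝ ({0, 1, Complex.I} : Set ℂ)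
    have m0 : (0:ℂ) ∈ convexHull ℝ ({0, 1, Complex.I} : Set ℂ) := subset_convexHull _ _ (by simp)
    have m1 : (1:ℂ) ∈ convexHull ℝ ({0, 1, Complex.I} : Set ℂ) := subset_convexHull _ _ (by simp)
    have m2 : Complex.I ∈ convexHull ℝ ({0, 1, Complex.I} : Set ℂ) :=
      subset_convexHull _ _ (by simp)
    have := hc.sum_mem (t := Finset.univ) (w := ![1 - w.re - w.im, w.re, w.im])
      (z := ![0, 1, Complex.I]) (by intro i _; fin_cases i <;> simp <;> linarith)
      (by simp [Fin.sum_univ_three]; ring) (by intro i _; fin_cases i <;> simp [m0, m1, m2])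
    simpa [Fin.sum_univ_three, Complex.re_add_im] using this

noncomputable def lmap (u v : ℂ) : ℂ →L[ℝ] ℂ :=
  Complex.reCLM.smulRight u + Complex.imCLM.smulRight v

lemma lmap_apply (u v w : ℂ) : lmap u v w = w.re * u + w.im * v := by
  simp [lmap]

lemma lmap_inj (A B C : ℂ) (h : ¬ Collinear ℝ ({A, B, C} : Set ℂ)) :
    Function.Injective (lmap (B - A) (C - A)) := by
  rw [injective_iff_map_eq_zero]
  intro w hw
  rw [lmap_apply] at hw
  by_contra hne
  apply h
  rw [collinear_iff_of_mem (p₀ := A) (by simp)]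
  by_cases hr : w.re = 0
  · have hi : w.im ≠ 0 := fun hi => hne (Complex.ext hr hi)
    have : C - A = 0 := by simpa [hr, hi] using hw
    refine ⟨B - A, ?_⟩
    rintro p (rfl | rfl | rfl)
    · exact ⟨0, by simp⟩
    · exact ⟨1, by simp⟩
    · exact ⟨0, by simpa [sub_eq_zero] using this⟩
  · have hr' : (w.re : ℂ) ≠ 0 := by exact_mod_cast hr
    refine ⟨C - A, ?_⟩
    rintro p (rfl | rfl | rfl)
    · exact ⟨0, by simp⟩
    · refine ⟨- w.im / w.re, ?_⟩
      simp only [Complex.real_smul, vadd_eq_add]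
      push_cast
      field_simp
      linear_combination hw
    · exact ⟨1, by simp⟩

lemma lmap_det (A B C : ℂ) (h : ¬ Collinear ℝ ({A, B, C} : Set ℂ)) :
    (lmap (B - A) (C - A)).det ≠ 0 := by
  have := LinearEquiv.isUnit_det' (LinearEquiv.ofInjectiveEndo
    (lmap (B - A) (C - A) : ℂ →ₗ[ℝ] ℂ) (lmap_inj A B C h))
  exact this.ne_zero

lemma hull_image (A B C : ℂ) : convexHull ℝ ({A, B, C} : Set ℂ) =
    (fun w => A + lmap (B - A) (C - A) w) ''
      {w : ℂ | 0 ≤ w.re ∧ 0 ≤ w.im ∧ w.re + w.im ≤ 1} := by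
  rw [← hull_std]
  have := AffineMap.image_convexHull
    ((lmap (B - A) (C - A) : ℂ →ₗ[ℝ] ℂ).toAffineMap + AffineMap.const ℝ ℂ A) ({0, 1, Complex.I} : Set ℂ)
  simp only [Set.image_insert_eq, Set.image_singleton] at this
  simp [lmap_apply] at this
  rw [← this]
  congr 1
  ext w
  simp [lmap_apply, add_comm]

lemma std_int (k : ℕ) (A B C : ℂ) (h1 : B ≠ C) (h2 : B ≠ A) (h3 : C ≠ A) :
   ∫ s in (0:ℝ)..1, ∫ t in (0:ℝ)..(1-s), (A + (s * (B - A) + t * (C - A)))^k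
     = hq k A B C / ((k+1)*(k+2)) := by
  have h1 := sub_ne_zero.2 h1
  have h2 := sub_ne_zero.2 h2
  have h3 := sub_ne_zero.2 h3
  have hk1 : (k:ℂ)+1 ≠ 0 := by exact_mod_cast k.succ_ne_zero
  have hk2 : (k:ℂ)+2 ≠ 0 := by exact_mod_cast (k+1).succ_ne_zero
  have key : ∀ (m : ℕ) (P Q : ℂ) (a b : ℝ), Q ≠ 0 → ∫ t in a..b, (P + t * Q)^m =
      (P + b * Q)^(m+1) / ((m+1) * Q) - (P + a * Q)^(m+1) / ((m+1) * Q) := by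
    intro m P Q a b hQ
    have hm : (m:ℂ)+1 ≠ 0 := by exact_mod_cast m.succ_ne_zero
    apply intervalIntegral.integral_eq_sub_of_hasDerivAt
      (f := fun t : ℝ => (P + t * Q)^(m+1) / ((m+1) * Q))
    · intro t _
      have h := (((Complex.ofRealCLM.hasDerivAt (x := t)).mul_const Q).const_add P).pow (m+1)
      have h := h.div_const ((m+1) * Q)
      refine HasDerivAt.congr_deriv (f' := _) h ?_
      simp
      field_simp
    · apply Continuous.intervalIntegrable
      fun_prop
  have e1 : ∀ s : ℝ, ∫ t in (0:ℝ)..(1-s), (A + (s * (B - A) + t * (C - A)))^k =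
      ((C + s * (B - C))^(k+1) - (A + s * (B-A))^(k+1)) / ((k+1) * (C-A)) := by
    intro s
    simp_rw [← add_assoc]
    rw [key _ _ _ _ _ h3, ← sub_div]
    congr 2
    · congr 1; push_cast; ring
    · simp
  simp_rw [e1]
  rw [intervalIntegral.integral_div, intervalIntegral.integral_sub, key _ _ _ _ _ h1, key _ _ _ _ _ h2]
  · unfold hq
    have : ((k+1:ℕ):ℂ) + 1 = k + 2 := by push_cast; ring
    rw [this]
    simp
    field_simp
  all_goals
    apply Continuous.intervalIntegrable
    fun_prop

lemma tri_prod (F : ℝ → ℝ → ℂ) (hF : Continuous fun p : ℝ × ℝ => F p.1 p.2) :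
    ∫ w in {w : ℂ | 0 ≤ w.re ∧ 0 ≤ w.im ∧ w.re + w.im ≤ 1}, F w.re w.im =
    ∫ s in (0:ℝ)..1, ∫ t in (0:ℝ)..(1-s), F s t := by
  set T : Set (ℝ × ℝ) := {p | 0 ≤ p.1 ∧ 0 ≤ p.2 ∧ p.1 + p.2 ≤ 1} with hT
  have hTc : IsClosed T := by
    rw [hT, Set.ofPred_and, Set.ofPred_and]
    apply IsClosed.inter (isClosed_le (by fun_prop) (by fun_prop))
    apply IsClosed.inter (isClosed_le (by fun_prop) (by fun_prop))
    exact (isClosed_le (by fun_prop) (by fun_prop))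
  have hTm := hTc.measurableSet
  have hTk : IsCompact T := by
    apply (isCompact_Icc (a := ((0:ℝ),(0:ℝ))) (b := (1,1))).of_isClosed_subset hTc
    rintro ⟨x, y⟩ ⟨h1, h2, h3⟩
    simp at h1 h2 h3
    refine ⟨⟨h1, h2⟩, ⟨?_, ?_⟩⟩ <;> simp <;> linarith
  have hIntg : IntegrableOn (fun p : ℝ × ℝ => F p.1 p.2) T := hF.continuousOn.integrableOn_compact hTk
  have e := Complex.volume_preserving_equiv_real_prod.setIntegral_preimage_emb
    (Complex.measurableEquivRealProd.measurableEmbedding) (fun p : ℝ × ℝ => F p.1 p.2) T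
  refine Eq.trans e ?_
  rw [← integral_indicator hTm, Measure.volume_eq_prod, integral_prod]
  · rw [intervalIntegral.integral_of_le zero_le_one, ← integral_Icc_eq_integral_Ioc,
      ← integral_indicator measurableSet_Icc]
    congr 1
    ext s
    by_cases hs : s ∈ Set.Icc (0:ℝ) 1
    · rw [Set.indicator_of_mem hs, intervalIntegral.integral_of_le (by linarith [hs.2]),
        ← integral_Icc_eq_integral_Ioc, ← integral_indicator measurableSet_Icc]
      congr 1
      ext t
      simp only [Set.indicator]
      congr 1
      simp only [hT, Set.mem_ofPred_eq, Set.mem_Icc, eq_iff_iff]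
      constructor
      · rintro ⟨_, h, h'⟩; exact ⟨h, by linarith⟩
      · rintro ⟨h, h'⟩; exact ⟨hs.1, h, by linarith⟩
    · rw [Set.indicator_of_notMem hs]
      rw [← integral_zero ℝ ℂ (μ := volume)]
      congr 1
      ext t
      apply Set.indicator_of_notMem
      rintro ⟨h1, h2, h3⟩
      simp at h1 h2 h3
      exact hs ⟨h1, by linarith⟩
  · rw [← Measure.volume_eq_prod]
    exact hIntg.integrable_indicator hTm

lemma moment (A B C : ℂ) (h1 : B ≠ C) (h2 : B ≠ A) (h3 : C ≠ A)
    (h : ¬ Collinear ℝ ({A, B, C} : Set ℂ)) :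
    ∃ D : ℂ, D ≠ 0 ∧ ∀ k : ℕ, ∫ w in convexHull ℝ ({A, B, C} : Set ℂ), w ^ k =
      D * (hq k A B C / ((k+1)*(k+2))) := by
  refine ⟨(|(lmap (B - A) (C - A)).det| : ℝ), ?_, ?_⟩
  · have := lmap_det A B C h
    exact_mod_cast abs_ne_zero.2 this
  · intro k
    have hm : MeasurableSet {w : ℂ | 0 ≤ w.re ∧ 0 ≤ w.im ∧ w.re + w.im ≤ 1} := by
      apply IsClosed.measurableSet
      rw [Set.ofPred_and, Set.ofPred_and]
      apply IsClosed.inter (isClosed_le (by fun_prop) (by fun_prop))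
      apply IsClosed.inter (isClosed_le (by fun_prop) (by fun_prop))
      exact (isClosed_le (by fun_prop) (by fun_prop))
    rw [hull_image, integral_image_eq_integral_abs_det_fderiv_smul volume hm
      (f' := fun _ => lmap (B - A) (C - A))]
    · rw [integral_smul, Complex.real_smul, ← std_int k A B C h1 h2 h3]
      congr 1
      simp_rw [lmap_apply]
      exact tri_prod (fun s t => (A + (s * (B - A) + t * (C - A)))^k) (by fun_prop)
    · intro x _
      exact ((lmap (B - A) (C - A)).hasFDerivAt.const_add A).hasFDerivWithinAt
    · intro x _ y _ hxy
      exact lmap_inj A B C h (add_left_cancel hxy)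

/-- Coefficient of `z_l^m` in the sum of `g_p (z_i^m - z_j^m)`. -/
noncomputable def nodeCoeff {n : ℕ} (g : PairIdx n → ℂ) (l : Fin (n+1)) : ℂ :=
  ∑ p : PairIdx n, g p * ((if p.1.1 = l then 1 else 0) - (if p.1.2 = l then 1 else 0))

lemma sum_nodeCoeff {n : ℕ} (g : PairIdx n → ℂ) (f : Fin (n+1) → ℂ) :
    ∑ l, nodeCoeff g l * f l = ∑ p : PairIdx n, g p * (f p.1.1 - f p.1.2) := by
  unfold nodeCoeff
  simp_rw [Finset.sum_mul]
  rw [Finset.sum_comm]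
  refine Finset.sum_congr rfl fun p _ => ?_
  simp_rw [mul_assoc, ← Finset.mul_sum, sub_mul, Finset.sum_sub_distrib]
  simp

lemma moments_iff_nodeCoeff {n : ℕ} (z : Fin (n+1) → ℂ) (hz : Function.Injective z)
    (g : PairIdx n → ℂ) :
    (∀ k : ℕ, ∑ p : PairIdx n, g p * (z p.1.1 ^ (k+1) - z p.1.2 ^ (k+1)) = 0) ↔
      ∀ l, nodeCoeff g l = 0 := by
  constructor
  · intro h
    have := Matrix.eq_zero_of_forall_pow_sum_mul_pow_eq_zero (f := z) (v := nodeCoeff g) hz ?_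
    · intro l; rw [this]; rfl
    · intro i
      rw [sum_nodeCoeff g (fun l => z l ^ (i:ℕ))]
      rcases hi : (i : ℕ) with _ | k
      · simp
      · exact h k
  · intro h k
    rw [← sum_nodeCoeff g (fun l => z l ^ (k+1))]
    simp [h]

lemma nodeCoeff_iff {n : ℕ} (hn : 2 ≤ n) (g : PairIdx n → ℂ) :
    (∀ l, nodeCoeff g l = 0) ↔ ∀ q : PairIdx n, ¬ 1 < (q.1.1 : ℕ) →
      g q = ∑ p : PairIdx n, if 1 < (p.1.1 : ℕ) then
        g p * ((if p.1.1 = q.1.2 then 1 else 0) - (if p.1.2 = q.1.2 then 1 else 0)) else 0 := by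
  classical
  have key : ∀ q : PairIdx n, ¬ 1 < (q.1.1 : ℕ) → nodeCoeff g q.1.2 =
      (∑ p : PairIdx n, if 1 < (p.1.1 : ℕ) then
        g p * ((if p.1.1 = q.1.2 then 1 else 0) - (if p.1.2 = q.1.2 then 1 else 0)) else 0)
        - g q := by
    intro q hq
    have e : g q = ∑ p : PairIdx n, if p = q then g p else 0 := by simp
    rw [e, ← Finset.sum_sub_distrib]
    unfold nodeCoeff
    refine Finset.sum_congr rfl fun p _ => ?_
    by_cases hp : 1 < (p.1.1 : ℕ)
    · have : p ≠ q := by rintro rfl; exact hq hp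
      simp [hp, this]
    · have h1 := p.2.1
      have h2 := q.2.1
      have h3 := q.2.2
      have h4 : p.1.1 ≠ q.1.2 := by
        intro h; rw [Fin.ext_iff] at h; omega
      have h5 : p.1.1 = q.1.1 := by rw [Fin.ext_iff]; omega
      by_cases hpq : p = q
      · subst hpq; simp [hp, h4]
      · have h6 : p.1.2 ≠ q.1.2 := fun h => hpq (Subtype.ext (Prod.ext h5 h))
        simp [hp, h4, h6, hpq]
  constructor
  · intro h q hq
    have := key q hq
    rw [h] at this
    linear_combination this
  · intro h
    have h2 : ∀ l : Fin (n+1), (l : ℕ) ≠ 1 → nodeCoeff g l = 0 := by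
      intro l hl
      by_cases h0 : (l : ℕ) = 0
      · unfold nodeCoeff
        refine Finset.sum_eq_zero fun p _ => ?_
        have h1 := p.2.1
        have h2 := p.2.2
        have h3 : p.1.1 ≠ l := by intro h; rw [Fin.ext_iff] at h; omega
        have h4 : p.1.2 ≠ l := by intro h; rw [Fin.ext_iff] at h; omega
        simp [h3, h4]
      · let q : PairIdx n := ⟨(⟨1, by omega⟩, l), by simp, by simp; omega⟩
        have hq : ¬ 1 < (q.1.1 : ℕ) := by simp [q]
        have := key q hq
        rw [← h q hq, sub_self] at this
        exact this
    intro l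
    by_cases hl : (l : ℕ) = 1
    · have hs := sum_nodeCoeff g (fun _ => 1)
      simp only [mul_one, sub_self, mul_zero, Finset.sum_const_zero] at hs
      rw [Finset.sum_eq_single l] at hs
      · exact hs
      · intro b _ hb
        apply h2
        intro h'
        exact hb (Fin.ext (by omega))
      · simp
    · exact h2 l hl

lemma shift_iff (x : ℂ) (S R : ℕ → ℂ) (h0 : R 0 = S 0)
    (h : ∀ k, R (k+1) = S (k+1) - x * S k) : (∀ k, S k = 0) ↔ ∀ k, R k = 0 := by
  constructor
  · intro hS k
    cases k with
    | zero => rw [h0, hS]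
    | succ k => rw [h, hS, hS]; simp
  · intro hR k
    induction k with
    | zero => rw [← h0, hR]
    | succ k ih =>
      have := h k
      rw [hR, ih] at this
      linear_combination -this

/-- For a nondegenerate tuple `z_0, …, z_n` (`n ≥ 2`): for every family
`a = (a_{ij})_{2 ≤ i < j ≤ n}` of complex numbers there is a unique family
`c = (c_{ij})_{1 ≤ i < j ≤ n}` with `c_{ij} = a_{ij}` for `2 ≤ i < j ≤ n` and all harmonic
moments `Σ_{1≤i<j≤n} c_{ij} ∫_{conv{z_0,z_i,z_j}} w^k dvol(w)` vanishing. Thus the space of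
complex null polygonal measures projects isomorphically onto the coordinates `2 ≤ i < j`. -/
theorem complex_null_measures_project_isomorphically
    (n : ℕ) (hn : 2 ≤ n) (z : Fin (n + 1) → ℂ) (hz : Nondegenerate z)
    (a : Fin (n + 1) → Fin (n + 1) → ℂ) :
    ∃! c : PairIdx n → ℂ,
      (∀ p : PairIdx n, 1 < (p.1.1 : ℕ) → c p = a p.1.1 p.1.2) ∧
      ∀ k : ℕ,
        ∑ p : PairIdx n,
          c p * ∫ w in convexHull ℝ ({z 0, z p.1.1, z p.1.2} : Set ℂ), w ^ k = 0 := by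
  classical
  have hmom : ∀ p : PairIdx n, ∃ D : ℂ, D ≠ 0 ∧ ∀ k : ℕ,
      ∫ w in convexHull ℝ ({z 0, z p.1.1, z p.1.2} : Set ℂ), w ^ k =
      D * (hq k (z 0) (z p.1.1) (z p.1.2) / ((k+1)*(k+2))) ∧
      (z p.1.1 ≠ z p.1.2 ∧ z p.1.1 ≠ z 0 ∧ z p.1.2 ≠ z 0) := by
    intro p
    have h1 := p.2.1
    have h2 := p.2.2
    have a1 : p.1.1 ≠ p.1.2 := by intro h; rw [Fin.ext_iff] at h; omega
    have h0 : ((0 : Fin (n+1)) : ℕ) = 0 := rfl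
    have a2 : p.1.1 ≠ 0 := by intro h; rw [Fin.ext_iff, h0] at h; omega
    have a3 : p.1.2 ≠ 0 := by intro h; rw [Fin.ext_iff, h0] at h; omega
    have b1 := hz.1.ne a1
    have b2 := hz.1.ne a2
    have b3 := hz.1.ne a3
    obtain ⟨D, hD, h⟩ := moment (z 0) (z p.1.1) (z p.1.2) b1 b2 b3
      (hz.2 _ _ _ a2.symm a3.symm a1)
    exact ⟨D, hD, fun k => ⟨h k, b1, b2, b3⟩⟩
  choose D hD hM using hmom
  -- the weight relating `c` and `g`
  let W : PairIdx n → ℂ := fun p => D p / (z p.1.1 - z p.1.2)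
  have hW : ∀ p, W p ≠ 0 := fun p => div_ne_zero (hD p) (sub_ne_zero.2 (hM p 0).2.1)
  have hiff : ∀ c : PairIdx n → ℂ,
      (∀ k : ℕ, ∑ p : PairIdx n,
          c p * ∫ w in convexHull ℝ ({z 0, z p.1.1, z p.1.2} : Set ℂ), w ^ k = 0) ↔
      ∀ q : PairIdx n, ¬ 1 < (q.1.1 : ℕ) →
      c q * W q = ∑ p : PairIdx n, if 1 < (p.1.1 : ℕ) then
        c p * W p * ((if p.1.1 = q.1.2 then 1 else 0) - (if p.1.2 = q.1.2 then 1 else 0))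
          else 0 := by
    intro c
    rw [← nodeCoeff_iff hn (fun p => c p * W p), ← moments_iff_nodeCoeff z hz.1,
      ← shift_iff (z 0) (fun k => ∑ p : PairIdx n, c p * D p * hq k (z 0) (z p.1.1) (z p.1.2))
        (fun k => ∑ p : PairIdx n, c p * W p * (z p.1.1 ^ (k+1) - z p.1.2 ^ (k+1)))]
    · refine forall_congr' fun k => ?_
      have hk1 : (k:ℂ)+1 ≠ 0 := by exact_mod_cast k.succ_ne_zero
      have hk2 : (k:ℂ)+2 ≠ 0 := by exact_mod_cast (k+1).succ_ne_zero
      have : ∑ p : PairIdx n,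
          c p * ∫ w in convexHull ℝ ({z 0, z p.1.1, z p.1.2} : Set ℂ), w ^ k =
          (∑ p : PairIdx n, c p * D p * hq k (z 0) (z p.1.1) (z p.1.2)) / ((k+1)*(k+2)) := by
        rw [Finset.sum_div]
        refine Finset.sum_congr rfl fun p _ => ?_
        rw [(hM p k).1]
        ring
      rw [this, div_eq_zero_iff]
      simp [hk1, hk2]
    · refine Finset.sum_congr rfl fun p _ => ?_
      obtain ⟨_, b1, b2, b3⟩ := hM p 0
      rw [hq_zero _ _ _ b1 b2 b3]
      simp only [W]
      ring
    · intro k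
      rw [Finset.mul_sum, ← Finset.sum_sub_distrib]
      refine Finset.sum_congr rfl fun p _ => ?_
      obtain ⟨_, b1, b2, b3⟩ := hM p 0
      have := hq_succ k _ _ _ b1 b2 b3
      simp only [W]
      linear_combination (-(c p * D p)) * this
  let E : PairIdx n → ℂ := fun q => ∑ p : PairIdx n, if 1 < (p.1.1 : ℕ) then
        a p.1.1 p.1.2 * W p * ((if p.1.1 = q.1.2 then 1 else 0) -
          (if p.1.2 = q.1.2 then 1 else 0)) else 0
  have hE : ∀ c : PairIdx n → ℂ, (∀ p : PairIdx n, 1 < (p.1.1 : ℕ) → c p = a p.1.1 p.1.2) →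
      ∀ q : PairIdx n, (∑ p : PairIdx n, if 1 < (p.1.1 : ℕ) then
        c p * W p * ((if p.1.1 = q.1.2 then 1 else 0) - (if p.1.2 = q.1.2 then 1 else 0))
          else 0) = E q := by
    intro c hc q
    refine Finset.sum_congr rfl fun p _ => ?_
    by_cases h1 : 1 < (p.1.1 : ℕ)
    · rw [if_pos h1, if_pos h1, hc p h1]
    · rw [if_neg h1, if_neg h1]
  refine ⟨fun q => if 1 < (q.1.1 : ℕ) then a q.1.1 q.1.2 else E q / W q, ⟨?_, ?_⟩, ?_⟩
  · intro p hp
    simp [hp]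
  · rw [hiff]
    intro q hq
    rw [hE _ (fun p hp => by simp [hp])]
    simp only [hq, if_false]
    exact div_mul_cancel₀ _ (hW q)
  · rintro c ⟨hc, hk⟩
    rw [hiff] at hk
    funext q
    by_cases hq : 1 < (q.1.1 : ℕ)
    · simp [hq, hc]
    · simp only [hq, if_false]
      rw [eq_div_iff (hW q), hk q hq, hE c hc]
end
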